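/- The Wang set 𝒯_D = 𝒯_a ∪ 𝒯_b is aperiodic: 𝒯_D tiles the plane, and no tiling of ℤ² by 𝒯_D is periodic. -/

import Mathlib

structure WangTile (H V : Type*) where
  west : H
  east : H
  south : V
  north : V
deriving DecidableEq

def TilingOn {H V : Type*} (T : Set (WangTile H V)) (X : Set (ℤ × ℤ))
    (f : ℤ × ℤ → WangTile H V) : Prop :=
  (∀ p ∈ X, f p ∈ T) ∧
  (∀ x y : ℤ, (x, y) ∈ X → (x + 1, y) ∈ X →
    (f (x, y)).east = (f (x + 1, y)).west) ∧
  (∀ x y : ℤ, (x, y) ∈ X → (x, y + 1) ∈ X →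
    (f (x, y)).north = (f (x, y + 1)).south)

def Tiling {H V : Type*} (T : Set (WangTile H V)) (f : ℤ × ℤ → WangTile H V) : Prop :=
  TilingOn T Set.univ f

def TilesPlane {H V : Type*} (T : Set (WangTile H V)) : Prop :=
  ∃ f, Tiling T f

def PeriodicTiling {H V : Type*} (f : ℤ × ℤ → WangTile H V) : Prop :=
  ∃ u v : ℤ, (u, v) ≠ (0, 0) ∧ ∀ x y : ℤ, f (x + u, y + v) = f (x, y)

def Aperiodic {H V : Type*} (T : Set (WangTile H V)) : Prop :=
  TilesPlane T ∧ ∀ f, Tiling T f → ¬ PeriodicTiling f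

def MinimallyAperiodic {H V : Type*} (T : Set (WangTile H V)) : Prop :=
  Aperiodic T ∧ ∀ S : Set (WangTile H V), S ⊂ T → ¬ TilesPlane S

/-- The twenty horizontal colors of the Wang set `𝒯_D = 𝒯_a ∪ 𝒯_b`
(`a,…,j` for `𝒯_a` and `K,…,R` for `𝒯_b`). -/
inductive HC
  | a | b | c | d | e | f | g | h | i | j
  | K | L | M | M' | N | O | O' | P | Q | R
deriving DecidableEq

open HC in
/-- The Wang set `𝒯_a`: horizontal colors `a,…,j`, vertical colors `0, 1`.
Tiles are written `⟨west, east, south, north⟩`. -/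
def Ta : Set (WangTile HC (Fin 2)) :=
  { ⟨a, b, 1, 0⟩, ⟨f, b, 1, 1⟩, ⟨g, a, 1, 1⟩, ⟨e, f, 1, 1⟩, ⟨c, d, 1, 0⟩,
    ⟨b, c, 1, 0⟩, ⟨b, g, 1, 1⟩, ⟨d, e, 1, 1⟩, ⟨i, j, 0, 0⟩, ⟨c, i, 0, 0⟩,
    ⟨d, h, 0, 0⟩, ⟨j, a, 0, 0⟩, ⟨h, c, 0, 0⟩, ⟨h, g, 0, 1⟩ }

open HC in
/-- The Wang set `𝒯_b`: horizontal colors `K,…,R`, vertical colors `0, 1`. -/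
def Tb : Set (WangTile HC (Fin 2)) :=
  { ⟨P, R, 1, 1⟩, ⟨M', K, 1, 1⟩, ⟨R, M, 1, 1⟩, ⟨R, M', 1, 1⟩, ⟨Q, O', 0, 0⟩,
    ⟨N, O, 0, 1⟩, ⟨P, Q, 0, 1⟩, ⟨M, N, 0, 1⟩, ⟨R, L, 0, 0⟩, ⟨K, L, 0, 1⟩,
    ⟨O, R, 0, 0⟩, ⟨O, P, 0, 1⟩, ⟨L, M, 0, 1⟩, ⟨O', R, 0, 0⟩ }

/-- The Wang set `𝒯_D = 𝒯_a ∪ 𝒯_b`. -/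
def TD : Set (WangTile HC (Fin 2)) := Ta ∪ Tb

namespace TDProof

/-- The five kinds of blocks. -/
inductive K | k1 | k2 | k3 | k4 | k5
deriving DecidableEq
open K

def len (p q : ℤ) : K → ℤ
  | k1 => p | k2 => p | k3 => q | k4 => q | k5 => 2 * p

@[simp, grind =] theorem len_k1 (p q : ℤ) : len p q k1 = p := rfl
@[simp, grind =] theorem len_k2 (p q : ℤ) : len p q k2 = p := rfl
@[simp, grind =] theorem len_k3 (p q : ℤ) : len p q k3 = q := rfl
@[simp, grind =] theorem len_k4 (p q : ℤ) : len p q k4 = q := rfl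
@[simp, grind =] theorem len_k5 (p q : ℤ) : len p q k5 = 2 * p := rfl

/-- Admissible parameters. -/
structure Par (p q : ℤ) : Prop where
  a : 8 * p ≤ 5 * q
  b : 8 * q ≤ 13 * p
  c : 5 ≤ p

theorem Par.step {p q : ℤ} (h : Par p q) : Par q (p + q) := by
  obtain ⟨a, b, c⟩ := h
  constructor <;> omega

/-- A bi-infinite chain of blocks. -/
structure Run (p q : ℤ) (H : ℤ → K → Prop) : Prop where
  ne : ∃ x k, H x k
  next : ∀ x k, H x k → ∃ k', H (x + len p q k) k'
  prev : ∀ x k, H x k → ∃ k', H (x - len p q k') k'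
  sep : ∀ x k y k', H x k → H y k' → x ≤ y → y < x + len p q k → x = y ∧ k = k'

def in2 (p q : ℤ) (H : ℤ → K → Prop) (x : ℤ) : Prop := H x k1 ∨ H (x - (q - p)) k5
def in3 (H : ℤ → K → Prop) (x : ℤ) : Prop := H x k3
def out2 (p q : ℤ) (H : ℤ → K → Prop) (x : ℤ) : Prop := H x k2 ∨ H (x - (2 * p - q)) k5
def out3 (p q : ℤ) (H : ℤ → K → Prop) (x : ℤ) : Prop := H (x - (q - p)) k4

structure Match (p q p' q' : ℤ) (B M : ℤ → K → Prop) : Prop where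
  m2 : ∀ x, out2 p q B x ↔ in2 p' q' M x
  m3 : ∀ x, out3 p q B x ↔ in3 M x

theorem len_pos {p q : ℤ} (h : Par p q) (k : K) : p ≤ len p q k := by
  obtain ⟨a, b, c⟩ := h
  cases k <;> simp <;> omega

theorem len_le {p q : ℤ} (h : Par p q) (k : K) : len p q k ≤ 2 * p := by
  obtain ⟨a, b, c⟩ := h
  cases k <;> simp <;> omega

section
variable {p q : ℤ} {H : ℤ → K → Prop}

theorem Run.nx (h : Run p q H) {x k} (hx : H x k) (y : ℤ) (hy : y = x + len p q k) :
    H y k1 ∨ H y k2 ∨ H y k3 ∨ H y k4 ∨ H y k5 := by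
  obtain ⟨k', hk⟩ := h.next x k hx
  subst hy
  cases k' <;> simp only [hk, true_or, or_true]

theorem Run.pv (h : Run p q H) {x k} (hx : H x k) :
    H (x - p) k1 ∨ H (x - p) k2 ∨ H (x - q) k3 ∨ H (x - q) k4 ∨ H (x - 2 * p) k5 := by
  obtain ⟨k', hk⟩ := h.prev x k hx
  cases k' <;> simp only [len_k1, len_k2, len_k3, len_k4, len_k5] at hk <;> simp only [hk, true_or, or_true]

theorem Run.sp (h : Run p q H) (hp : Par p q) {x k y k'} (hx : H x k) (hy : H y k') :
    (x = y ∧ k = k') ∨ (x ≠ y ∧ x + len p q k ≤ y) ∨ (x ≠ y ∧ y + len p q k' ≤ x) := by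
  have a := h.sep x k y k' hx hy
  have b := h.sep y k' x k hy hx
  have l1 := len_pos hp k
  have l2 := hp.c
  rcases lt_trichotomy x y with h1 | h1 | h1
  · right; left; refine ⟨h1.ne, ?_⟩; by_contra h2; exact h1.ne (a h1.le (not_le.1 h2)).1
  · left; exact a h1.le (by omega)
  · right; right; refine ⟨h1.ne', ?_⟩; by_contra h2; exact h1.ne (b h1.le (not_le.1 h2)).1

/-- Hubs are unbounded below. -/
theorem Run.low (h : Run p q H) (hp : Par p q) (z : ℤ) : ∃ x k, x ≤ z ∧ H x k := by
  obtain ⟨x0, k0, h0⟩ := h.ne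
  have : ∀ n : ℕ, ∃ x k, x ≤ x0 - n ∧ H x k := by
    intro n
    induction n with
    | zero => exact ⟨x0, k0, by simp, h0⟩
    | succ n ih =>
      obtain ⟨x, k, h1, h2⟩ := ih
      obtain ⟨k', hk⟩ := h.prev x k h2
      have := len_pos hp k'
      have := hp.c
      exact ⟨_, k', by push_cast; omega, hk⟩
  obtain ⟨x, k, h1, h2⟩ := this (x0 - z).toNat
  exact ⟨x, k, by omega, h2⟩

/-- Every position lies in a block. -/
theorem cover_of {L : K → ℤ} (hL : ∀ k, 0 < L k) (low : ∀ z, ∃ x k, x ≤ z ∧ H x k)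
    (next : ∀ x k, H x k → ∃ k', H (x + L k) k') (z : ℤ) :
    ∃ x k, H x k ∧ x ≤ z ∧ z < x + L k := by
  obtain ⟨x0, k0, h0, h1⟩ := low z
  have : ∀ n : ℕ, (∃ x k, H x k ∧ x ≤ z ∧ z < x + L k) ∨ (∃ x k, H x k ∧ x0 + n ≤ x ∧ x ≤ z) := by
    intro n
    induction n with
    | zero => exact Or.inr ⟨x0, k0, h1, by simp, h0⟩
    | succ n ih =>
      rcases ih with ih | ⟨x, k, a, b, c⟩
      · exact Or.inl ih
      · by_cases hz : z < x + L k
        · exact Or.inl ⟨x, k, a, c, hz⟩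
        · obtain ⟨k', hk⟩ := next x k a
          have := hL k
          exact Or.inr ⟨_, k', hk, by push_cast; omega, by omega⟩
  rcases this (z - x0 + 1).toNat with h | ⟨x, k, a, b, c⟩
  · exact h
  · omega

theorem Run.cover (h : Run p q H) (hp : Par p q) (z : ℤ) :
    ∃ x k, H x k ∧ x ≤ z ∧ z < x + len p q k :=
  cover_of (fun k => by have := len_pos hp k; have := hp.c; omega) (h.low hp) h.next z

/-- A run can be built from `low`, `next`, `sep`. -/
theorem Run.mk' (hp : Par p q) (low : ∀ z, ∃ x k, x ≤ z ∧ H x k)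
    (next : ∀ x k, H x k → ∃ k', H (x + len p q k) k')
    (sep : ∀ x k y k', H x k → H y k' → x ≤ y → y < x + len p q k → x = y ∧ k = k') :
    Run p q H where
  ne := by obtain ⟨x, k, _, h⟩ := low 0; exact ⟨x, k, h⟩
  next := next
  prev := by
    intro x k hx
    obtain ⟨y, k', hy, h1, h2⟩ := cover_of (L := len p q)
      (fun k => by have := len_pos hp k; have := hp.c; omega) low next (x - 1)
    refine ⟨k', ?_⟩
    obtain ⟨k'', hk⟩ := next y k' hy
    have : x = y + len p q k' := by
      by_contra hne
      have := (sep y k' x k hy hx (by omega) (by omega)).1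
      omega
    rw [this]; simpa using hy
  sep := sep

theorem Run.shift (h : Run p q H) (s : ℤ) : Run p q (fun x k => H (x - s) k) where
  ne := by obtain ⟨x, k, h⟩ := h.ne; exact ⟨x + s, k, by simpa using h⟩
  next := by
    intro x k hx
    obtain ⟨k', hk⟩ := h.next _ _ hx
    exact ⟨k', by convert hk using 1; ring⟩
  prev := by
    intro x k hx
    obtain ⟨k', hk⟩ := h.prev _ _ hx
    exact ⟨k', by convert hk using 1; ring⟩
  sep := by
    intro x k y k' hx hy h1 h2
    have := h.sep _ _ _ _ hx hy (by omega) (by omega)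
    exact ⟨by omega, this.2⟩

def dk : K → K
  | k1 => k2 | k2 => k1 | k3 => k4 | k4 => k3 | k5 => k5

/-- Reflected run. -/
def dual (p q c : ℤ) (H : ℤ → K → Prop) : ℤ → K → Prop := fun y k => H (c - y - len p q k) (dk k)

theorem dk_dk (k : K) : dk (dk k) = k := by cases k <;> rfl
theorem len_dk (k : K) : len p q (dk k) = len p q k := by cases k <;> rfl

theorem Run.dual (h : Run p q H) (hp : Par p q) (c : ℤ) : Run p q (dual p q c H) where
  ne := by
    obtain ⟨x, k, h⟩ := h.ne
    exact ⟨c - x - len p q k, dk k, by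
      simp only [TDProof.dual, dk_dk, len_dk]
      convert h using 1; ring⟩
  next := by
    intro x k hx
    obtain ⟨k', hk⟩ := h.prev _ _ hx
    refine ⟨dk k', ?_⟩
    simp only [TDProof.dual, dk_dk, len_dk]
    convert hk using 1; ring
  prev := by
    intro x k hx
    obtain ⟨k', hk⟩ := h.next _ _ hx
    refine ⟨dk k', ?_⟩
    simp only [TDProof.dual, dk_dk, len_dk] at hk ⊢
    convert hk using 1; ring
  sep := by
    intro x k y k' hx hy h1 h2
    have hs := h.sp hp hx hy
    have l1 := len_pos hp k
    have l2 := len_pos hp k'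
    have := hp.c
    simp only [len_dk] at hs
    rcases hs with ⟨h3, h4⟩ | h3 | h3
    · have : k = k' := by rw [← dk_dk k, h4, dk_dk]
      subst this
      exact ⟨by omega, rfl⟩
    · omega
    · omega

end
end TDProof

namespace TDProof
open K

/-- output marks of a run at level `(q, p+q)` -/
def om (p q : ℤ) (B : ℤ → K → Prop) (x : ℤ) : Prop := B x k2 ∨ B (x - (q - p)) k5 ∨ B (x - p) k4

def Hub (B : ℤ → K → Prop) (x : ℤ) : Prop := ∃ k, B x k

theorem Bstep {p q : ℤ} {B : ℤ → K → Prop} (hp : Par p q) (hB : Run q (p + q) B) {z y : ℤ}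
    (hz : Hub B z) (hy : om p q B y) (h1 : z ≤ y) (hn : ∀ w, z ≤ w → w < y → ¬ om p q B w) :
    (y = z ∧ B y k2) ∨ (y = z + (q - p) ∧ B (y - (q - p)) k5) ∨ (y = z + p ∧ B (y - p) k4) ∨
    (z + q ≤ y ∧ Hub B (z + q)) ∨ (z + (p + q) ≤ y ∧ Hub B (z + (p + q))) := by
  obtain ⟨k, hk⟩ := hz
  have hp' := hp.step
  have sp := fun {x k y k'} => @Run.sp _ _ _ hB hp' x k y k'
  have nx := hB.next z k hk
  obtain ⟨pa, pb, pc⟩ := hp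
  have key : ∀ s k', B s k' → (s = z ∧ k' = k) ∨ (s ≠ z ∧ z + len q (p + q) k ≤ s) ∨
      (s ≠ z ∧ s + len q (p+q) k' ≤ z) := fun s k' h => by
    rcases sp hk h with ⟨a, b⟩ | ⟨a, b⟩ | ⟨a, b⟩
    · exact Or.inl ⟨a.symm, b.symm⟩
    · exact Or.inr (Or.inl ⟨fun h => a h.symm, b⟩)
    · exact Or.inr (Or.inr ⟨fun h => a h.symm, b⟩)
  have hn2 : k = k2 → z < y → False := fun h h' => hn z le_rfl h' (Or.inl (h ▸ hk))
  have hn5 : k = k5 → z + (q - p) < y → False := fun h h' =>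
    hn (z + (q - p)) (by omega) h' (Or.inr (Or.inl (by subst h; simpa using hk)))
  have hn4 : k = k4 → z + p < y → False := fun h h' =>
    hn (z + p) (by omega) h' (Or.inr (Or.inr (by subst h; simpa using hk)))
  rcases hy with hy | hy | hy <;> have := key _ _ hy <;> clear key sp <;>
    cases k <;> simp at this nx hn2 hn4 hn5 <;> first | (exfalso; omega) | grind [Hub]

/-- Distances between consecutive output marks. -/
theorem gapB {p q : ℤ} {B : ℤ → K → Prop} (hp : Par p q) (hB : Run q (p + q) B) {x y : ℤ}
    (hx : om p q B x) (hy : om p q B y) (h1 : x < y) (h2 : y < x + 3 * q)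
    (hn : ∀ w, x < w → w < y → ¬ om p q B w) :
    ((B x k2 ∨ B (x - p) k4) ∧
      (B y k2 ∧ (y - x = q ∨ y - x = 2 * q ∨ y - x = p + 2 * q) ∨
       B (y - (q - p)) k5 ∧ (y - x = 2 * q - p ∨ y - x = 3 * q - p) ∨
       B (y - p) k4 ∧ (y - x = p + q ∨ y - x = p + 2 * q))) ∨
    (B (x - (q - p)) k5 ∧
      (B y k2 ∧ (y - x = p + q ∨ y - x = p + 2 * q) ∨
       B (y - (q - p)) k5 ∧ (y - x = 2 * q) ∨
       B (y - p) k4 ∧ (y - x = 2 * p + q))) := by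
  have st := fun {z y} => @Bstep p q B hp hB z y
  have hp' := hp.step
  have sp := fun {x k y k'} => @Run.sp _ _ _ hB hp' x k y k'
  have pa := hp.a
  have pb := hp.b
  have pc := hp.c
  have main : ∀ z, Hub B z → x < z → z ≤ y → y < z + 2 * q →
       (B y k2 ∧ (y - z = 0 ∨ y - z = q ∨ y - z = p + q) ∨
       B (y - (q - p)) k5 ∧ (y - z = q - p ∨ y - z = 2 * q - p) ∨
       B (y - p) k4 ∧ (y - z = p ∨ y - z = p + q)) := by
    intro z hz xz zy yz
    have n1 : ∀ w, z ≤ w → w < y → ¬ om p q B w := fun w a b => hn w (by omega) b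
    rcases st hz hy zy n1 with h | h | h | ⟨h, h'⟩ | ⟨h, h'⟩
    · grind
    · grind
    · grind
    · rcases st h' hy h (fun w a b => n1 w (by omega) b) with h | h | h | ⟨h, h'⟩ | ⟨h, h'⟩
      · grind
      · grind
      · grind
      · omega
      · omega
    · rcases st h' hy h (fun w a b => n1 w (by omega) b) with h | h | h | ⟨h, h'⟩ | ⟨h, h'⟩
      · grind
      · grind
      · grind
      · omega
      · omega
  rcases hx with hx | hx | hx
  · have zy : x + q ≤ y := by
      rcases hy with hy | hy | hy <;> have := sp hx hy <;> simp at this <;> omega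
    have := main (x + q) (hB.next _ _ hx) (by omega) zy (by omega)
    left
    refine ⟨Or.inl hx, ?_⟩
    grind
  · have zy : x + (p + q) ≤ y := by
      rcases hy with hy | hy | hy <;> have := sp hx hy <;> simp at this <;> omega
    have := main (x + (p + q)) (by
      have := hB.next _ _ hx; simp only [len_k5] at this; unfold Hub; convert this using 3; ring) (by omega) zy (by omega)
    right
    refine ⟨hx, ?_⟩
    grind
  · have zy : x + q ≤ y := by
      rcases hy with hy | hy | hy <;> have := sp hx hy <;> simp at this <;> omega
    have := main (x + q) (by
      have := hB.next _ _ hx; simp only [len_k4] at this; unfold Hub; convert this using 3; ring) (by omega) zy (by omega)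
    left
    refine ⟨Or.inr hx, ?_⟩
    grind

end TDProof

namespace TDProof
open K

structure BM (p q : ℤ) (B M : ℤ → K → Prop) : Prop where
  hp : Par p q
  hB : Run q (p + q) B
  hM : Run p q M
  hm : Match q (p + q) p q B M

def im (p q : ℤ) (M : ℤ → K → Prop) (x : ℤ) : Prop := M x k1 ∨ M (x - (q - p)) k5 ∨ M x k3

/-- no input marks in `[a, b)` -/
def NI (p q : ℤ) (M : ℤ → K → Prop) (a b : ℤ) : Prop := ∀ w, a ≤ w → w < b → ¬ im p q M w

theorem NI.join {p q : ℤ} {M : ℤ → K → Prop} {a b c : ℤ} (h : NI p q M a b) (h' : NI p q M b c) :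
    NI p q M a c := by
  intro w h1 h2
  by_cases h3 : w < b
  · exact h w h1 h3
  · exact h' w (by omega) h2

section
variable {p q : ℤ} {B M : ℤ → K → Prop}

theorem NI1 (hp : Par p q) (hM : Run p q M) {x} (h : M x k1) : NI p q M (x + 1) (x + p) := by
  rintro w h1 h2 (hw | hw | hw) <;> have := hM.sp hp h hw <;> obtain ⟨a, b, c⟩ := hp <;> simp at this <;> omega
theorem NI2 (hp : Par p q) (hM : Run p q M) {x} (h : M x k2) : NI p q M x (x + p) := by
  rintro w h1 h2 (hw | hw | hw) <;> have := hM.sp hp h hw <;> obtain ⟨a, b, c⟩ := hp <;> simp at this <;> omega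
theorem NI3 (hp : Par p q) (hM : Run p q M) {x} (h : M x k3) : NI p q M (x + 1) (x + q) := by
  rintro w h1 h2 (hw | hw | hw) <;> have := hM.sp hp h hw <;> obtain ⟨a, b, c⟩ := hp <;> simp at this <;> omega
theorem NI4 (hp : Par p q) (hM : Run p q M) {x} (h : M x k4) : NI p q M x (x + q) := by
  rintro w h1 h2 (hw | hw | hw) <;> have := hM.sp hp h hw <;> obtain ⟨a, b, c⟩ := hp <;> simp at this <;> omega
theorem NI5 (hp : Par p q) (hM : Run p q M) {x} (h : M x k5) : NI p q M (x + (q - p) + 1) (x + 2 * p) := by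
  rintro w h1 h2 (hw | hw | hw) <;> have := hM.sp hp h hw <;> obtain ⟨a, b, c⟩ := hp <;> simp at this <;> omega

theorem BM.o2 (t : BM p q B M) (x : ℤ) : (B x k2 ∨ B (x - (q - p)) k5) ↔ (M x k1 ∨ M (x - (q - p)) k5) := by
  have := t.hm.m2 x
  unfold out2 in2 at this
  rwa [show 2 * q - (p + q) = q - p by ring] at this

theorem BM.o3 (t : BM p q B M) (x : ℤ) : B (x - p) k4 ↔ M x k3 := by
  have := t.hm.m3 x
  unfold out3 in3 at this
  rwa [show p + q - q = p by ring] at this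

theorem BM.om (t : BM p q B M) (x : ℤ) : om p q B x ↔ im p q M x := by
  have := t.o2 x
  have := t.o3 x
  unfold TDProof.om im
  tauto

theorem BM.ex (t : BM p q B M) (x : ℤ) (h2 : B x k2 ∨ B (x - (q - p)) k5) (h3 : B (x - p) k4) : False := by
  obtain ⟨a, b, c⟩ := t.hp
  rcases h2 with h | h <;> have := t.hB.sp t.hp.step h h3 <;> simp at this <;> omega

theorem BM.g22 (t : BM p q B M) {x y : ℤ} (hx : M x k1 ∨ M (x - (q - p)) k5)
    (hy : M y k1 ∨ M (y - (q - p)) k5) (h1 : x < y)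
    (h2 : y < x + 3 * q) (hn : NI p q M (x + 1) y) :
    (B x k2 ∧ (B y k2 ∧ (y - x = q ∨ y - x = 2 * q ∨ y - x = p + 2 * q) ∨
       B (y - (q - p)) k5 ∧ (y - x = 2 * q - p ∨ y - x = 3 * q - p))) ∨
    (B (x - (q - p)) k5 ∧
      (B y k2 ∧ (y - x = p + q ∨ y - x = p + 2 * q) ∨
       B (y - (q - p)) k5 ∧ (y - x = 2 * q))) := by
  have := gapB t.hp t.hB ((t.om x).2 (by unfold im; tauto)) ((t.om y).2 (by unfold im; tauto)) h1 h2
    (fun w a b => by rw [t.om]; exact hn w (by omega) b)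
  have e1 := t.ex x ((t.o2 x).2 hx)
  have e2 := t.ex y ((t.o2 y).2 hy)
  tauto

theorem BM.g23 (t : BM p q B M) {x y : ℤ} (hx : M x k1 ∨ M (x - (q - p)) k5)
    (hy : M y k3) (h1 : x < y)
    (h2 : y < x + 3 * q) (hn : NI p q M (x + 1) y) :
    (B x k2 ∧ (y - x = p + q ∨ y - x = p + 2 * q)) ∨
    (B (x - (q - p)) k5 ∧ (y - x = 2 * p + q)) := by
  have := gapB t.hp t.hB ((t.om x).2 (by unfold im; tauto)) ((t.om y).2 (by unfold im; tauto)) h1 h2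
    (fun w a b => by rw [t.om]; exact hn w (by omega) b)
  have e1 := t.ex x ((t.o2 x).2 hx)
  have e2 := fun h => t.ex y h ((t.o3 y).2 hy)
  tauto

theorem BM.g32 (t : BM p q B M) {x y : ℤ} (hx : M x k3)
    (hy : M y k1 ∨ M (y - (q - p)) k5) (h1 : x < y)
    (h2 : y < x + 3 * q) (hn : NI p q M (x + 1) y) :
    (B y k2 ∧ (y - x = q ∨ y - x = 2 * q ∨ y - x = p + 2 * q) ∨
       B (y - (q - p)) k5 ∧ (y - x = 2 * q - p ∨ y - x = 3 * q - p)) := by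
  have := gapB t.hp t.hB ((t.om x).2 (by unfold im; tauto)) ((t.om y).2 (by unfold im; tauto)) h1 h2
    (fun w a b => by rw [t.om]; exact hn w (by omega) b)
  have e1 := fun h => t.ex x h ((t.o3 x).2 hx)
  have e2 := t.ex y ((t.o2 y).2 hy)
  tauto

theorem BM.g33 (t : BM p q B M) {x y : ℤ} (hx : M x k3)
    (hy : M y k3) (h1 : x < y)
    (h2 : y < x + 3 * q) (hn : NI p q M (x + 1) y) :
    y - x = p + q ∨ y - x = p + 2 * q := by
  have := gapB t.hp t.hB ((t.om x).2 (by unfold im; tauto)) ((t.om y).2 (by unfold im; tauto)) h1 h2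
    (fun w a b => by rw [t.om]; exact hn w (by omega) b)
  have e1 := fun h => t.ex x h ((t.o3 x).2 hx)
  have e2 := fun h => t.ex y h ((t.o3 y).2 hy)
  tauto

/-! Forbidden words coming from the row below. -/

theorem NI5b (hp : Par p q) (hM : Run p q M) {x} (h : M x k5) : NI p q M x (x + (q - p)) := by
  rintro w h1 h2 (hw | hw | hw) <;> have := hM.sp hp h hw <;> obtain ⟨a, b, c⟩ := hp <;> simp at this <;> omega

theorem BM.f11 (t : BM p q B M) {x} (a : M x k1) (b : M (x + p) k1) : False := by
  have ⟨pa, pb, pc⟩ := t.hp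
  have := t.g22 (x := x) (y := x + p) (Or.inl a) (Or.inl b) (by omega) (by omega) (NI1 t.hp t.hM a)
  omega

theorem BM.f13 (t : BM p q B M) {x} (a : M x k1) (b : M (x + p) k3) : False := by
  have ⟨pa, pb, pc⟩ := t.hp
  have := t.g23 (x := x) (y := x + p) (Or.inl a) b (by omega) (by omega) (NI1 t.hp t.hM a)
  omega

theorem BM.f33 (t : BM p q B M) {x} (a : M x k3) (b : M (x + q) k3) : False := by
  have ⟨pa, pb, pc⟩ := t.hp
  have := t.g33 (x := x) (y := x + q) a b (by omega) (by omega) (NI3 t.hp t.hM a)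
  omega

theorem BM.f51 (t : BM p q B M) {x} (a : M x k5) (b : M (x + 2 * p) k1) : False := by
  have ⟨pa, pb, pc⟩ := t.hp
  have := t.g22 (x := x + (q - p)) (y := x + 2 * p) (Or.inr (by simpa using a)) (Or.inl b) (by omega) (by omega) (NI5 t.hp t.hM a)
  omega

theorem BM.f53 (t : BM p q B M) {x} (a : M x k5) (b : M (x + 2 * p) k3) : False := by
  have ⟨pa, pb, pc⟩ := t.hp
  have := t.g23 (x := x + (q - p)) (y := x + 2 * p) (Or.inr (by simpa using a)) b (by omega) (by omega) (NI5 t.hp t.hM a)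
  omega

theorem BM.f55 (t : BM p q B M) {x} (a : M x k5) (b : M (x + 2 * p) k5) : False := by
  have ⟨pa, pb, pc⟩ := t.hp
  have := t.g22 (x := x + (q - p)) (y := x + 2 * p + (q - p)) (Or.inr (by simpa using a)) (Or.inr (by simpa using b)) (by omega) (by omega) ((NI5 t.hp t.hM a).join (NI5b t.hp t.hM b))
  omega

theorem BM.f121 (t : BM p q B M) {x} (a : M x k1) (b : M (x + p) k2) (c : M (x + p + p) k1) : False := by
  have ⟨pa, pb, pc⟩ := t.hp
  have := t.g22 (x := x) (y := x + p + p) (Or.inl a) (Or.inl c) (by omega) (by omega) ((NI1 t.hp t.hM a).join (NI2 t.hp t.hM b))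
  omega

theorem BM.f123 (t : BM p q B M) {x} (a : M x k1) (b : M (x + p) k2) (c : M (x + p + p) k3) : False := by
  have ⟨pa, pb, pc⟩ := t.hp
  have := t.g23 (x := x) (y := x + p + p) (Or.inl a) c (by omega) (by omega) ((NI1 t.hp t.hM a).join (NI2 t.hp t.hM b))
  omega

theorem BM.f321 (t : BM p q B M) {x} (a : M x k3) (b : M (x + q) k2) (c : M (x + q + p) k1) : False := by
  have ⟨pa, pb, pc⟩ := t.hp
  have := t.g32 (x := x) (y := x + q + p) a (Or.inl c) (by omega) (by omega) ((NI3 t.hp t.hM a).join (NI2 t.hp t.hM b))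
  omega

theorem BM.f343 (t : BM p q B M) {x} (a : M x k3) (b : M (x + q) k4) (c : M (x + q + q) k3) : False := by
  have ⟨pa, pb, pc⟩ := t.hp
  have := t.g33 (x := x) (y := x + q + q) a c (by omega) (by omega) ((NI3 t.hp t.hM a).join (NI4 t.hp t.hM b))
  omega

theorem BM.f521 (t : BM p q B M) {x} (a : M x k5) (b : M (x + 2 * p) k2) (c : M (x + 2 * p + p) k1) : False := by
  have ⟨pa, pb, pc⟩ := t.hp
  have := t.g22 (x := x + (q - p)) (y := x + 2 * p + p) (Or.inr (by simpa using a)) (Or.inl c) (by omega) (by omega) ((NI5 t.hp t.hM a).join (NI2 t.hp t.hM b))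
  omega

theorem BM.f523 (t : BM p q B M) {x} (a : M x k5) (b : M (x + 2 * p) k2) (c : M (x + 2 * p + p) k3) : False := by
  have ⟨pa, pb, pc⟩ := t.hp
  have := t.g23 (x := x + (q - p)) (y := x + 2 * p + p) (Or.inr (by simpa using a)) c (by omega) (by omega) ((NI5 t.hp t.hM a).join (NI2 t.hp t.hM b))
  omega

theorem BM.f541 (t : BM p q B M) {x} (a : M x k5) (b : M (x + 2 * p) k4) (c : M (x + 2 * p + q) k1) : False := by
  have ⟨pa, pb, pc⟩ := t.hp
  have := t.g22 (x := x + (q - p)) (y := x + 2 * p + q) (Or.inr (by simpa using a)) (Or.inl c) (by omega) (by omega) ((NI5 t.hp t.hM a).join (NI4 t.hp t.hM b))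
  omega

theorem BM.f543 (t : BM p q B M) {x} (a : M x k5) (b : M (x + 2 * p) k4) (c : M (x + 2 * p + q) k3) : False := by
  have ⟨pa, pb, pc⟩ := t.hp
  have := t.g23 (x := x + (q - p)) (y := x + 2 * p + q) (Or.inr (by simpa using a)) c (by omega) (by omega) ((NI5 t.hp t.hM a).join (NI4 t.hp t.hM b))
  omega

theorem BM.f5241 (t : BM p q B M) {x} (a : M x k5) (b : M (x + 2 * p) k2) (c : M (x + 2 * p + p) k4) (d : M (x + 2 * p + p + q) k1) : False := by
  have ⟨pa, pb, pc⟩ := t.hp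
  have := t.g22 (x := x + (q - p)) (y := x + 2 * p + p + q) (Or.inr (by simpa using a)) (Or.inl d) (by omega) (by omega) (((NI5 t.hp t.hM a).join (NI2 t.hp t.hM b)).join (NI4 t.hp t.hM c))
  omega

theorem BM.f5243 (t : BM p q B M) {x} (a : M x k5) (b : M (x + 2 * p) k2) (c : M (x + 2 * p + p) k4) (d : M (x + 2 * p + p + q) k3) : False := by
  have ⟨pa, pb, pc⟩ := t.hp
  have := t.g23 (x := x + (q - p)) (y := x + 2 * p + p + q) (Or.inr (by simpa using a)) d (by omega) (by omega) (((NI5 t.hp t.hM a).join (NI2 t.hp t.hM b)).join (NI4 t.hp t.hM c))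
  omega

end
end TDProof

namespace TDProof
open K

structure Trip (p q : ℤ) (B M A : ℤ → K → Prop) : Prop where
  bm : BM p q B M
  hA : Run q (p + q) A
  hm : Match p q q (p + q) M A

section
variable {p q : ℤ} {B M A : ℤ → K → Prop}

theorem Trip.dual (t : Trip p q B M A) :
    Trip p q (dual q (p + q) 0 A) (dual p q (p - q) M) (dual q (p + q) 0 B) where
  bm :=
    { hp := t.bm.hp
      hB := t.hA.dual t.bm.hp.step 0
      hM := t.bm.hM.dual t.bm.hp (p - q)
      hm :=
        { m2 := fun x => by
            have := t.hm.m2 (- x - q)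
            unfold in2 out2 at *
            simp only [TDProof.dual, len_k1, len_k2, len_k5, dk]
            ring_nf at *
            tauto
          m3 := fun x => by
            have := t.hm.m3 (- x - q)
            unfold in3 out3 at *
            simp only [TDProof.dual, len_k3, len_k4, dk]
            ring_nf at *
            tauto } }
  hA := t.bm.hB.dual t.bm.hp.step 0
  hm :=
    { m2 := fun x => by
        have := t.bm.hm.m2 (- x - q)
        unfold in2 out2 at *
        simp only [TDProof.dual, len_k1, len_k2, len_k5, dk]
        ring_nf at *
        tauto
      m3 := fun x => by
        have := t.bm.hm.m3 (- x - q)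
        unfold in3 out3 at *
        simp only [TDProof.dual, len_k3, len_k4, dk]
        ring_nf at *
        tauto }

theorem Trip.f22 (t : Trip p q B M A) {x} (a : M x k2) (b : M (x + p) k2) : False :=
  t.dual.bm.f11 (x := p - q - (x + p + p)) (by unfold TDProof.dual; simp only [len_k1, dk]; convert b using 1; ring) (by unfold TDProof.dual; simp only [len_k1, dk]; convert a using 1; ring)

theorem Trip.f42 (t : Trip p q B M A) {x} (a : M x k4) (b : M (x + q) k2) : False :=
  t.dual.bm.f13 (x := p - q - (x + q + p)) (by unfold TDProof.dual; simp only [len_k1, dk]; convert b using 1; ring) (by unfold TDProof.dual; simp only [len_k3, dk]; convert a using 1; ring)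

theorem Trip.f44 (t : Trip p q B M A) {x} (a : M x k4) (b : M (x + q) k4) : False :=
  t.dual.bm.f33 (x := p - q - (x + q + q)) (by unfold TDProof.dual; simp only [len_k3, dk]; convert b using 1; ring) (by unfold TDProof.dual; simp only [len_k3, dk]; convert a using 1; ring)

theorem Trip.f25 (t : Trip p q B M A) {x} (a : M x k2) (b : M (x + p) k5) : False :=
  t.dual.bm.f51 (x := p - q - (x + p + 2 * p)) (by unfold TDProof.dual; simp only [len_k5, dk]; convert b using 1; ring) (by unfold TDProof.dual; simp only [len_k1, dk]; convert a using 1; ring)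

theorem Trip.f45 (t : Trip p q B M A) {x} (a : M x k4) (b : M (x + q) k5) : False :=
  t.dual.bm.f53 (x := p - q - (x + q + 2 * p)) (by unfold TDProof.dual; simp only [len_k5, dk]; convert b using 1; ring) (by unfold TDProof.dual; simp only [len_k3, dk]; convert a using 1; ring)

theorem Trip.f55 (t : Trip p q B M A) {x} (a : M x k5) (b : M (x + 2 * p) k5) : False :=
  t.dual.bm.f55 (x := p - q - (x + 2 * p + 2 * p)) (by unfold TDProof.dual; simp only [len_k5, dk]; convert b using 1; ring) (by unfold TDProof.dual; simp only [len_k5, dk]; convert a using 1; ring)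

theorem Trip.f212 (t : Trip p q B M A) {x} (a : M x k2) (b : M (x + p) k1) (c : M (x + p + p) k2) : False :=
  t.dual.bm.f121 (x := p - q - (x + p + p + p)) (by unfold TDProof.dual; simp only [len_k1, dk]; convert c using 1; ring) (by unfold TDProof.dual; simp only [len_k2, dk]; convert b using 1; ring) (by unfold TDProof.dual; simp only [len_k1, dk]; convert a using 1; ring)

theorem Trip.f412 (t : Trip p q B M A) {x} (a : M x k4) (b : M (x + q) k1) (c : M (x + q + p) k2) : False :=
  t.dual.bm.f123 (x := p - q - (x + q + p + p)) (by unfold TDProof.dual; simp only [len_k1, dk]; convert c using 1; ring) (by unfold TDProof.dual; simp only [len_k2, dk]; convert b using 1; ring) (by unfold TDProof.dual; simp only [len_k3, dk]; convert a using 1; ring)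

theorem Trip.f214 (t : Trip p q B M A) {x} (a : M x k2) (b : M (x + p) k1) (c : M (x + p + p) k4) : False :=
  t.dual.bm.f321 (x := p - q - (x + p + p + q)) (by unfold TDProof.dual; simp only [len_k3, dk]; convert c using 1; ring) (by unfold TDProof.dual; simp only [len_k2, dk]; convert b using 1; ring) (by unfold TDProof.dual; simp only [len_k1, dk]; convert a using 1; ring)

theorem Trip.f434 (t : Trip p q B M A) {x} (a : M x k4) (b : M (x + q) k3) (c : M (x + q + q) k4) : False :=
  t.dual.bm.f343 (x := p - q - (x + q + q + q)) (by unfold TDProof.dual; simp only [len_k3, dk]; convert c using 1; ring) (by unfold TDProof.dual; simp only [len_k4, dk]; convert b using 1; ring) (by unfold TDProof.dual; simp only [len_k3, dk]; convert a using 1; ring)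

theorem Trip.no5 (t : Trip p q B M A) {x} (h : M x k5) : False := by
  have nx := fun {x k} => @Run.nx _ _ _ t.bm.hM x k
  rcases nx h _ rfl with a | a | a | a | a
  · exact t.bm.f51 h a
  · rcases nx a _ rfl with b | b | b | b | b
    · exact t.bm.f521 h a b
    · exact t.f22 a b
    · exact t.bm.f523 h a b
    · rcases nx b _ rfl with c | c | c | c | c
      · exact t.bm.f5241 h a b c
      · exact t.f42 b c
      · exact t.bm.f5243 h a b c
      · exact t.f44 b c
      · exact t.f45 b c
    · exact t.f25 a b
  · exact t.bm.f53 h a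
  · rcases nx a _ rfl with b | b | b | b | b
    · exact t.bm.f541 h a b
    · exact t.f42 a b
    · exact t.bm.f543 h a b
    · exact t.f44 a b
    · exact t.f45 a b
  · exact t.bm.f55 h a

/-- successors in `M` -/
theorem Trip.nx (t : Trip p q B M A) {x k} (h : M x k) (y) (hy : y = x + len p q k) :
    M y k1 ∨ M y k2 ∨ M y k3 ∨ M y k4 := by
  rcases t.bm.hM.nx h y hy with a | a | a | a | a
  · exact Or.inl a
  · exact Or.inr (Or.inl a)
  · exact Or.inr (Or.inr (Or.inl a))
  · exact Or.inr (Or.inr (Or.inr a))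
  · exact (t.no5 a).elim

theorem Trip.pv (t : Trip p q B M A) {y k} (h : M y k) :
    (∃ x, y = x + p ∧ M x k1) ∨ (∃ x, y = x + p ∧ M x k2) ∨ (∃ x, y = x + q ∧ M x k3) ∨
    (∃ x, y = x + q ∧ M x k4) := by
  rcases t.bm.hM.pv h with a | a | a | a | a
  · exact Or.inl ⟨_, by ring, a⟩
  · exact Or.inr (Or.inl ⟨_, by ring, a⟩)
  · exact Or.inr (Or.inr (Or.inl ⟨_, by ring, a⟩))
  · exact Or.inr (Or.inr (Or.inr ⟨_, by ring, a⟩))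
  · exact (t.no5 a).elim

theorem Trip.no5B (t : Trip p q B M A) {z} (h : B z k5) : False := by
  obtain ⟨x, rfl⟩ : ∃ x, z = x - (q - p) := ⟨z + (q - p), by ring⟩
  have m := (t.bm.o2 x).1 (Or.inr h)
  have ⟨pa, pb, pc⟩ := t.bm.hp
  have hn : ¬ B x k2 := fun h' => by
    have := t.bm.hB.sp t.bm.hp.step h h'
    simp at this; omega
  have hP := t.bm.hp
  have hM := t.bm.hM
  rcases m with m | m
  · rcases t.pv m with ⟨x, rfl, a⟩ | ⟨x, rfl, a⟩ | ⟨x, rfl, a⟩ | ⟨x, rfl, a⟩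
    · exact t.bm.f11 a m
    · rcases t.pv a with ⟨x, rfl, b⟩ | ⟨x, rfl, b⟩ | ⟨x, rfl, b⟩ | ⟨x, rfl, b⟩
      · exact t.bm.f121 b a m
      · exact t.f22 b a
      · exact t.bm.f321 b a m
      · exact t.f42 b a
    · have := t.bm.g32 a (Or.inl m) (by omega) (by omega) (NI3 hP hM a)
      grind
    · rcases t.pv a with ⟨x, rfl, b⟩ | ⟨x, rfl, b⟩ | ⟨x, rfl, b⟩ | ⟨x, rfl, b⟩
      · have := t.bm.g22 (Or.inl b) (Or.inl m) (by omega) (by omega) ((NI1 hP hM b).join (NI4 hP hM a))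
        grind
      · rcases t.pv b with ⟨x, rfl, c⟩ | ⟨x, rfl, c⟩ | ⟨x, rfl, c⟩ | ⟨x, rfl, c⟩
        · have := t.bm.g22 (Or.inl c) (Or.inl m) (by omega) (by omega)
            ((NI1 hP hM c).join ((NI2 hP hM b).join (NI4 hP hM a)))
          grind
        · exact t.f22 c b
        · have := t.bm.g32 c (Or.inl m) (by omega) (by omega)
            ((NI3 hP hM c).join ((NI2 hP hM b).join (NI4 hP hM a)))
          grind
        · exact t.f42 c b
      · have := t.bm.g32 b (Or.inl m) (by omega) (by omega) ((NI3 hP hM b).join (NI4 hP hM a))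
        grind
      · exact t.f44 b a
  · exact t.no5 m

theorem Trip.no5A (t : Trip p q B M A) {z} (h : A z k5) : False :=
  t.dual.no5B (z := - z - 2 * q) (by unfold TDProof.dual; simp only [len_k5, dk]; convert h using 1; ring)

/-- `1` is followed by `4 3`. -/
theorem Trip.s1 (t : Trip p q B M A) {x} (h : M x k1) : M (x + p) k4 ∧ M (x + p + q) k3 := by
  have ⟨pa, pb, pc⟩ := t.bm.hp
  have hP := t.bm.hp
  have hM := t.bm.hM
  have n5 := fun {z} => @Trip.no5B _ _ _ _ _ t z
  rcases t.nx h _ rfl with a | a | a | a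
  · exact (t.bm.f11 h a).elim
  · rcases t.nx a _ rfl with b | b | b | b
    · exact (t.bm.f121 h a b).elim
    · exact (t.f22 a b).elim
    · exact (t.bm.f123 h a b).elim
    · rcases t.nx b _ rfl with c | c | c | c
      · have := t.bm.g22 (Or.inl h) (Or.inl c) (by simp; omega) (by simp; omega)
          ((NI1 hP hM h).join ((NI2 hP hM a).join (NI4 hP hM b)))
        simp at this; grind
      · exact (t.f42 b c).elim
      · have := t.bm.g23 (Or.inl h) c (by simp; omega) (by simp; omega)
          ((NI1 hP hM h).join ((NI2 hP hM a).join (NI4 hP hM b)))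
        simp at this; grind
      · exact (t.f44 b c).elim
  · exact (t.bm.f13 h a).elim
  · refine ⟨a, ?_⟩
    rcases t.nx a _ rfl with b | b | b | b
    · have := t.bm.g22 (Or.inl h) (Or.inl b) (by simp; omega) (by simp; omega)
          ((NI1 hP hM h).join (NI4 hP hM a))
      simp at this; grind
    · exact (t.f42 a b).elim
    · exact b
    · exact (t.f44 a b).elim

/-- `2` is preceded by `4 3`. -/
theorem Trip.s2 (t : Trip p q B M A) {x} (h : M x k2) : M (x - q) k3 ∧ M (x - q - q) k4 := by
  have := t.dual.s1 (x := - x - q) (by unfold TDProof.dual; simp only [len_k1, dk]; convert h using 1; ring)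
  unfold TDProof.dual at this
  simp only [len_k4, len_k3, dk] at this
  constructor
  · convert this.1 using 1; ring
  · convert this.2 using 1; ring

theorem Trip.f21 (t : Trip p q B M A) {x} (h : M x k2) (a : M (x + p) k1) : False :=
  t.bm.f321 (t.s2 h).1 (by simpa using h) (by simpa using a)

/-- `HHH` position: a common hub preceded by `4 3`. -/
def HHH (q : ℤ) (M : ℤ → K → Prop) (y : ℤ) : Prop := M (y - q) k3 ∧ M (y - q - q) k4

/-- Words of `M` between consecutive `HHH` positions. -/
theorem Trip.words (t : Trip p q B M A) {y} (h : HHH q M y) :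
    (M y k1 ∧ M (y + p) k4 ∧ M (y + p + q) k3) ∨
    (M y k2 ∧ M (y + p) k4 ∧ M (y + p + q) k3) ∨
    (M y k2 ∧ M (y + p) k4 ∧ M (y + p + q) k1 ∧ M (y + p + q + p) k4 ∧ M (y + p + q + p + q) k3) ∨
    (M y k2 ∧ M (y + p) k3 ∧ M (y + p + q) k1 ∧ M (y + p + q + p) k4 ∧ M (y + p + q + p + q) k3) ∨
    (M y k2 ∧ M (y + p) k3 ∧ M (y + p + q) k4 ∧ M (y + p + q + q) k1 ∧ M (y + p + q + q + p) k4 ∧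
      M (y + p + q + q + p + q) k3) := by
  have ⟨pa, pb, pc⟩ := t.bm.hp
  obtain ⟨h3, h4⟩ := h
  rcases t.nx h3 y (by simp) with a | a | a | a
  · exact Or.inl ⟨a, t.s1 a⟩
  · right
    rcases t.nx a _ rfl with b | b | b | b
    · exact (t.f21 a b).elim
    · exact (t.f22 a b).elim
    · right; right
      rcases t.nx b _ rfl with c | c | c | c
      · exact Or.inl ⟨a, b, c, t.s1 c⟩
      · have := t.bm.hM.sp t.bm.hp (t.s2 c).2 a
        simp at this; omega
      · exact (t.bm.f33 b c).elim
      · rcases t.nx c _ rfl with d | d | d | d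
        · exact Or.inr ⟨a, b, c, d, t.s1 d⟩
        · exact (t.f42 c d).elim
        · exact (t.bm.f343 b c d).elim
        · exact (t.f44 c d).elim
    · rcases t.nx b _ rfl with c | c | c | c
      · exact Or.inr (Or.inl ⟨a, b, c, t.s1 c⟩)
      · exact (t.f42 b c).elim
      · exact Or.inl ⟨a, b, c⟩
      · exact (t.f44 b c).elim
  · exact (t.bm.f33 h3 (by simpa using a)).elim
  · exact (t.f434 h4 (by simpa using h3) (by simpa using a)).elim

/-- `HHH` positions exist arbitrarily far to the left. -/
theorem Trip.low (t : Trip p q B M A) (z : ℤ) : ∃ y ≤ z, HHH q M y := by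
  obtain ⟨x, k, hx, h⟩ := t.bm.hM.low t.bm.hp (z - 6 * q)
  have ⟨pa, pb, pc⟩ := t.bm.hp
  have c1 : ∀ x, M x k1 → HHH q M (x + p + 2 * q) := fun x h => by
    have := t.s1 h
    constructor
    · convert this.2 using 1; ring
    · convert this.1 using 1; ring
  have c4 : ∀ x, M x k4 → HHH q M (x + 2 * q) ∨ HHH q M (x + p + 3 * q) := fun x h => by
    rcases t.nx h _ rfl with a | a | a | a
    · right; convert c1 _ a using 1; simp; ring
    · exact (t.f42 h a).elim
    · left
      constructor
      · convert a using 1; simp; ring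
      · convert h using 1; ring
    · exact (t.f44 h a).elim
  cases k with
  | k1 => exact ⟨_, by omega, c1 _ h⟩
  | k2 => exact ⟨x, by omega, t.s2 h⟩
  | k5 => exact (t.no5 h).elim
  | k4 => rcases c4 _ h with h | h <;> exact ⟨_, by omega, h⟩
  | k3 =>
    rcases t.nx h _ rfl with a | a | a | a
    · exact ⟨_, by simp; omega, c1 _ a⟩
    · exact ⟨_, by simp; omega, t.s2 a⟩
    · exact (t.bm.f33 h a).elim
    · rcases c4 _ a with h | h <;> exact ⟨_, by simp; omega, h⟩

end
end TDProof

namespace TDProof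
open K
set_option linter.all false

def tot (p q : ℤ) : List K → ℤ
  | [] => 0
  | k :: l => len p q k + tot p q l

/-- the blocks `l` occur in `H` from position `y` on -/
def Chain (p q : ℤ) (H : ℤ → K → Prop) : ℤ → List K → Prop
  | _, [] => True
  | y, k :: l => H y k ∧ Chain p q H (y + len p q k) l

/-- `(x, k)` is one of the blocks of the chain `l` put at `y` -/
def InC (p q : ℤ) : ℤ → List K → ℤ → K → Prop
  | _, [], _, _ => False
  | y, k :: l, x, k' => (x = y ∧ k' = k) ∨ InC p q (y + len p q k) l x k'

def Dec (p q : ℤ) (H G : ℤ → K → Prop) (β : K → List K) : Prop :=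
  ∀ x k, H x k ↔ ∃ y k', G y k' ∧ InC p q y (β k') x k

section
variable {p q : ℤ} {H : ℤ → K → Prop}

theorem tot_nonneg (hp : Par p q) (l : List K) : 0 ≤ tot p q l := by
  induction l with
  | nil => simp [tot]
  | cons k l ih => have := len_pos hp k; have := hp.c; simp only [tot]; omega

theorem InC.chain {y : ℤ} {l : List K} {x k} (hc : Chain p q H y l) (h : InC p q y l x k) :
    H x k := by
  induction l generalizing y with
  | nil => exact h.elim
  | cons k0 l ih =>
    rcases h with ⟨rfl, rfl⟩ | h
    · exact hc.1
    · exact ih hc.2 h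

theorem InC.bd (hp : Par p q) {y : ℤ} {l : List K} {x k} (h : InC p q y l x k) :
    y ≤ x ∧ x + len p q k ≤ y + tot p q l := by
  induction l generalizing y with
  | nil => exact h.elim
  | cons k0 l ih =>
    have := len_pos hp k0; have := hp.c
    have := tot_nonneg hp l
    simp only [tot]
    rcases h with ⟨rfl, rfl⟩ | h
    · omega
    · have := ih h; omega

theorem InC.uniq (hp : Par p q) {y : ℤ} {l : List K} {x k x' k'} (h : InC p q y l x k)
    (h' : InC p q y l x' k') (h1 : x ≤ x') (h2 : x' < x + len p q k) : x = x' ∧ k = k' := by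
  induction l generalizing y with
  | nil => exact h.elim
  | cons k0 l ih =>
    have := len_pos hp k0; have := hp.c
    rcases h with ⟨rfl, rfl⟩ | h <;> rcases h' with ⟨rfl, rfl⟩ | h'
    · exact ⟨rfl, rfl⟩
    · have := InC.bd hp h'; omega
    · have := InC.bd hp h; omega
    · exact ih h h'

theorem InC.next {y : ℤ} {l : List K} {x k} (h : InC p q y l x k) :
    (∃ k', InC p q y l (x + len p q k) k') ∨ x + len p q k = y + tot p q l := by
  induction l generalizing y with
  | nil => exact h.elim
  | cons k0 l ih =>
    simp only [tot]
    rcases h with ⟨rfl, rfl⟩ | h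
    · cases l with
      | nil => right; simp [tot]
      | cons k' l => left; exact ⟨k', Or.inr (Or.inl ⟨rfl, rfl⟩)⟩
    · rcases ih h with ⟨k', h⟩ | h
      · exact Or.inl ⟨k', Or.inr h⟩
      · right; omega

theorem Chain.inC (hH : Run p q H) {y : ℤ} {l : List K} (hc : Chain p q H y l)
    {x k} (h : H x k) (h1 : y ≤ x) (h2 : x < y + tot p q l) : InC p q y l x k := by
  induction l generalizing y with
  | nil => simp [tot] at h2; omega
  | cons k0 l ih =>
    by_cases hx : x < y + len p q k0
    · left
      have := hH.sep _ _ _ _ hc.1 h h1 hx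
      exact ⟨this.1.symm, this.2.symm⟩
    · right
      exact ih hc.2 (by omega) (by simp only [tot] at h2; omega)

variable {P Q : ℤ} {G : ℤ → K → Prop} {β : K → List K}

/-- A run with blocks decomposing into chains gives a decomposition. -/
theorem Dec.of (hP : Par P Q) (hH : Run p q H) (hG : Run P Q G)
    (hβ : ∀ k, tot p q (β k) = len P Q k) (hc : ∀ y k, G y k → Chain p q H y (β k)) :
    Dec p q H G β := by
  intro x k
  constructor
  · intro h
    obtain ⟨y, k', hy, h1, h2⟩ := hG.cover hP x
    exact ⟨y, k', hy, (hc _ _ hy).inC hH h h1 (by rw [hβ]; exact h2)⟩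
  · rintro ⟨y, k', hy, h⟩
    exact h.chain (hc _ _ hy)

/-- Substituting chains into a run gives a run. -/
theorem Dec.run (hp : Par p q) (hP : Par P Q) (hG : Run P Q G)
    (hβ : ∀ k, tot p q (β k) = len P Q k) (hd : Dec p q H G β) : Run p q H := by
  have start : ∀ y k, G y k → ∃ k', H y k' := by
    intro y k h
    rcases hl : β k with _ | ⟨k0, l⟩
    · have := hβ k
      have := len_pos hP k
      have := hP.c
      simp [hl, tot] at *
      omega
    · exact ⟨k0, (hd _ _).2 ⟨y, k, h, by rw [hl]; exact Or.inl ⟨rfl, rfl⟩⟩⟩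
  apply Run.mk' hp
  · intro z
    obtain ⟨x, k, hx, h⟩ := hG.low hP z
    obtain ⟨k', hk⟩ := start x k h
    exact ⟨x, k', hx, hk⟩
  · intro x k h
    obtain ⟨y, k', hy, h⟩ := (hd _ _).1 h
    rcases h.next with ⟨k'', h⟩ | h
    · exact ⟨k'', (hd _ _).2 ⟨y, k', hy, h⟩⟩
    · rw [h, hβ]
      obtain ⟨k'', h⟩ := hG.next _ _ hy
      exact start _ _ h
  · intro x k x' k' h h' h1 h2
    obtain ⟨y, j, hy, h⟩ := (hd _ _).1 h
    obtain ⟨y', j', hy', h'⟩ := (hd _ _).1 h'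
    have b := h.bd hp
    have b' := h'.bd hp
    rw [hβ] at b b'
    have := len_pos hp k'
    have := hp.c
    have : y = y' ∧ j = j' := by
      rcases hG.sp hP hy hy' with h | h | h
      · exact h
      · omega
      · omega
    obtain ⟨rfl, rfl⟩ := this
    exact h.uniq hp h' h1 h2

end

def bB : K → List K
  | k1 => [k1, k4] | k2 => [k2, k4] | k3 => [k3, k2, k4] | k4 => [k4, k2, k4]
  | k5 => [k4, k1, k2, k4]
def bM : K → List K
  | k1 => [k2, k4, k3] | k2 => [k1, k4, k3] | k3 => [k2, k4, k1, k4, k3]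
  | k4 => [k2, k3, k1, k4, k3] | k5 => [k2, k3, k4, k1, k4, k3]
def bA : K → List K
  | k1 => [k1, k3] | k2 => [k2, k3] | k3 => [k1, k3, k3] | k4 => [k1, k4, k3]
  | k5 => [k1, k2, k3, k3]

section
variable {p q : ℤ} {B M A G : ℤ → K → Prop}

theorem totB (k : K) : tot q (p + q) (bB k) = len (p + 2 * q) (2 * p + 3 * q) k := by
  cases k <;> simp [bB, tot] <;> ring
theorem totM (k : K) : tot p q (bM k) = len (p + 2 * q) (2 * p + 3 * q) k := by
  cases k <;> simp [bM, tot] <;> ring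
theorem totA (k : K) : tot q (p + q) (bA k) = len (p + 2 * q) (2 * p + 3 * q) k := by
  cases k <;> simp [bA, tot] <;> ring

theorem Dec.B1 (h : Dec q (p + q) B G bB) (x : ℤ) : B x k1 ↔
    G x k1 ∨ G (x - (p + q)) k5 := by
  rw [h]
  constructor
  · rintro ⟨y, k, h, hm⟩
    cases k <;> simp [bB, InC] at hm <;> grind
  · rintro (h | h) <;> refine ⟨_, _, h, ?_⟩ <;> simp [bB, InC] <;> omega
theorem Dec.B2 (h : Dec q (p + q) B G bB) (x : ℤ) : B x k2 ↔
    G x k2 ∨ G (x - (p + q)) k3 ∨ G (x - (p + q)) k4 ∨ G (x - (p + 2 * q)) k5 := by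
  rw [h]
  constructor
  · rintro ⟨y, k, h, hm⟩
    cases k <;> simp [bB, InC] at hm <;> grind
  · rintro (h | h | h | h) <;> refine ⟨_, _, h, ?_⟩ <;> simp [bB, InC] <;> omega
theorem Dec.B3 (h : Dec q (p + q) B G bB) (x : ℤ) : B x k3 ↔
    G x k3 := by
  rw [h]
  constructor
  · rintro ⟨y, k, h, hm⟩
    cases k <;> simp [bB, InC] at hm <;> grind
  · rintro (h) <;> refine ⟨_, _, h, ?_⟩ <;> simp [bB, InC] <;> omega
theorem Dec.B4 (h : Dec q (p + q) B G bB) (x : ℤ) : B x k4 ↔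
    G (x - (q)) k1 ∨ G (x - (q)) k2 ∨ G (x - (p + 2 * q)) k3 ∨ G x k4 ∨ G (x - (p + 2 * q)) k4 ∨ G x k5 ∨ G (x - (p + 3 * q)) k5 := by
  rw [h]
  constructor
  · rintro ⟨y, k, h, hm⟩
    cases k <;> simp [bB, InC] at hm <;> grind
  · rintro (h | h | h | h | h | h | h) <;> refine ⟨_, _, h, ?_⟩ <;> simp [bB, InC] <;> omega
theorem Dec.B5 (h : Dec q (p + q) B G bB) (x : ℤ) : B x k5 ↔
    False := by
  rw [h]
  constructor
  · rintro ⟨y, k, h, hm⟩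
    cases k <;> simp [bB, InC] at hm <;> grind
  · exact False.elim
theorem Dec.M1 (h : Dec p q M G bM) (x : ℤ) : M x k1 ↔
    G x k2 ∨ G (x - (p + q)) k3 ∨ G (x - (p + q)) k4 ∨ G (x - (p + 2 * q)) k5 := by
  rw [h]
  constructor
  · rintro ⟨y, k, h, hm⟩
    cases k <;> simp [bM, InC] at hm <;> grind
  · rintro (h | h | h | h) <;> refine ⟨_, _, h, ?_⟩ <;> simp [bM, InC] <;> omega
theorem Dec.M2 (h : Dec p q M G bM) (x : ℤ) : M x k2 ↔
    G x k1 ∨ G x k3 ∨ G x k4 ∨ G x k5 := by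
  rw [h]
  constructor
  · rintro ⟨y, k, h, hm⟩
    cases k <;> simp [bM, InC] at hm <;> grind
  · rintro (h | h | h | h) <;> refine ⟨_, _, h, ?_⟩ <;> simp [bM, InC] <;> omega
theorem Dec.M3 (h : Dec p q M G bM) (x : ℤ) : M x k3 ↔
    G (x - (p + q)) k1 ∨ G (x - (p + q)) k2 ∨ G (x - (2 * p + 2 * q)) k3 ∨ G (x - (p)) k4 ∨ G (x - (2 * p + 2 * q)) k4 ∨ G (x - (p)) k5 ∨ G (x - (2 * p + 3 * q)) k5 := by
  rw [h]
  constructor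
  · rintro ⟨y, k, h, hm⟩
    cases k <;> simp [bM, InC] at hm <;> grind
  · rintro (h | h | h | h | h | h | h) <;> refine ⟨_, _, h, ?_⟩ <;> simp [bM, InC] <;> omega
theorem Dec.M4 (h : Dec p q M G bM) (x : ℤ) : M x k4 ↔
    G (x - (p)) k1 ∨ G (x - (p)) k2 ∨ G (x - (p)) k3 ∨ G (x - (2 * p + q)) k3 ∨ G (x - (2 * p + q)) k4 ∨ G (x - (p + q)) k5 ∨ G (x - (2 * p + 2 * q)) k5 := by
  rw [h]
  constructor
  · rintro ⟨y, k, h, hm⟩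
    cases k <;> simp [bM, InC] at hm <;> grind
  · rintro (h | h | h | h | h | h | h) <;> refine ⟨_, _, h, ?_⟩ <;> simp [bM, InC] <;> omega
theorem Dec.M5 (h : Dec p q M G bM) (x : ℤ) : M x k5 ↔
    False := by
  rw [h]
  constructor
  · rintro ⟨y, k, h, hm⟩
    cases k <;> simp [bM, InC] at hm <;> grind
  · exact False.elim
theorem Dec.A1 (h : Dec q (p + q) A G bA) (x : ℤ) : A x k1 ↔
    G x k1 ∨ G x k3 ∨ G x k4 ∨ G x k5 := by
  rw [h]
  constructor
  · rintro ⟨y, k, h, hm⟩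
    cases k <;> simp [bA, InC] at hm <;> grind
  · rintro (h | h | h | h) <;> refine ⟨_, _, h, ?_⟩ <;> simp [bA, InC] <;> omega
theorem Dec.A2 (h : Dec q (p + q) A G bA) (x : ℤ) : A x k2 ↔
    G x k2 ∨ G (x - (q)) k5 := by
  rw [h]
  constructor
  · rintro ⟨y, k, h, hm⟩
    cases k <;> simp [bA, InC] at hm <;> grind
  · rintro (h | h) <;> refine ⟨_, _, h, ?_⟩ <;> simp [bA, InC] <;> omega
theorem Dec.A3 (h : Dec q (p + q) A G bA) (x : ℤ) : A x k3 ↔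
    G (x - (q)) k1 ∨ G (x - (q)) k2 ∨ G (x - (q)) k3 ∨ G (x - (p + 2 * q)) k3 ∨ G (x - (p + 2 * q)) k4 ∨ G (x - (2 * q)) k5 ∨ G (x - (p + 3 * q)) k5 := by
  rw [h]
  constructor
  · rintro ⟨y, k, h, hm⟩
    cases k <;> simp [bA, InC] at hm <;> grind
  · rintro (h | h | h | h | h | h | h) <;> refine ⟨_, _, h, ?_⟩ <;> simp [bA, InC] <;> omega
theorem Dec.A4 (h : Dec q (p + q) A G bA) (x : ℤ) : A x k4 ↔
    G (x - (q)) k4 := by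
  rw [h]
  constructor
  · rintro ⟨y, k, h, hm⟩
    cases k <;> simp [bA, InC] at hm <;> grind
  · rintro (h) <;> refine ⟨_, _, h, ?_⟩ <;> simp [bA, InC] <;> omega
theorem Dec.A5 (h : Dec q (p + q) A G bA) (x : ℤ) : A x k5 ↔
    False := by
  rw [h]
  constructor
  · rintro ⟨y, k, h, hm⟩
    cases k <;> simp [bA, InC] at hm <;> grind
  · exact False.elim

end
end TDProof

namespace TDProof
open K
set_option linter.all false

theorem mv {M : ℤ → K → Prop} {a b : ℤ} {k : K} (h : M a k) (e : a = b) : M b k := e ▸ h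

/-- The composed run, read off from the middle row. -/
def comp (p q : ℤ) (M : ℤ → K → Prop) (y : ℤ) (k : K) : Prop :=
  HHH q M y ∧ Chain p q M y (bM k)

section
variable {p q : ℤ} {B M A : ℤ → K → Prop}

theorem Trip.b3 (t : Trip p q B M A) {z} (h : M z k3) : B (z - p) k4 := (t.bm.o3 z).2 h
theorem Trip.b1 (t : Trip p q B M A) {z} (h : M z k1) : B z k2 := by
  rcases (t.bm.o2 z).2 (Or.inl h) with h | h
  · exact h
  · exact (t.no5B h).elim
theorem Trip.b2' (t : Trip p q B M A) {z} (h : B z k2) : M z k1 := by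
  rcases (t.bm.o2 z).1 (Or.inl h) with h | h
  · exact h
  · exact (t.no5 h).elim
theorem Trip.b4' (t : Trip p q B M A) {z} (h : B z k4) : M (z + p) k3 := by
  apply (t.bm.o3 _).1
  exact mv h (by ring)
theorem Trip.a2 (t : Trip p q B M A) {z} (h : M z k2) : A z k1 := by
  rcases (t.hm.m2 z).1 (Or.inl h) with h | h
  · exact h
  · exact (t.no5A h).elim
theorem Trip.a4 (t : Trip p q B M A) {z} (h : M z k4) : A (z + (q - p)) k3 := by
  apply (t.hm.m3 (z + (q - p))).1
  exact mv h (by ring)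
theorem Trip.a1' (t : Trip p q B M A) {z} (h : A z k1) : M z k2 := by
  rcases (t.hm.m2 z).2 (Or.inl h) with h | h
  · exact h
  · exact (t.no5 h).elim
theorem Trip.a3' (t : Trip p q B M A) {z} (h : A z k3) : M (z - (q - p)) k4 :=
  (t.hm.m3 z).2 h

theorem Run.fill1 {H : ℤ → K → Prop} (hp : Par p q) (h : Run q (p + q) H) {z z' k}
    (hz : Hub H z) (h' : H z' k) (e : z' = z + q) : H z k1 ∨ H z k2 := by
  obtain ⟨k0, h0⟩ := hz
  have := h.sp hp.step h0 h'
  obtain ⟨pa, pb, pc⟩ := hp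
  have l := len_pos (p := p) (q := q) ⟨pa, pb, pc⟩ k
  have l' := len_pos (p := q) (q := p + q) (Par.step ⟨pa, pb, pc⟩) k
  cases k0 <;> simp at this
  · exact Or.inl h0
  · exact Or.inr h0
  all_goals omega

theorem Run.fill3 {H : ℤ → K → Prop} (hp : Par p q) (h : Run q (p + q) H) {z z' k}
    (hz : Hub H z) (h' : H z' k) (e : z' = z + (p + q)) : H z k3 ∨ H z k4 := by
  obtain ⟨k0, h0⟩ := hz
  obtain ⟨j, hj⟩ := h.next _ _ h0
  have := h.sp hp.step h0 h'
  have := h.sp hp.step hj h'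
  have l := len_pos hp.step k
  have l' := len_pos hp.step j
  obtain ⟨pa, pb, pc⟩ := hp
  cases k0 <;> simp at *
  · omega
  · omega
  · exact Or.inl h0
  · exact Or.inr h0
  · omega

theorem Run.kne (h : Run p q M) (hp : Par p q) {x y k k'} (h1 : M x k) (h2 : M y k')
    (hk : k ≠ k') (e : x = y) : False := by
  subst e
  have := len_pos hp k
  have := hp.c
  exact hk (h.sep _ _ _ _ h1 h2 le_rfl (by omega)).2

theorem Trip.hubB (t : Trip p q B M A) {y} (h : HHH q M y) : Hub B y := by
  obtain ⟨k, hk⟩ := t.bm.hB.next _ _ (t.b3 h.1)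
  exact ⟨k, mv hk (by simp; ring)⟩

theorem Trip.hubA (t : Trip p q B M A) {y} (h : HHH q M y) : Hub A y := by
  obtain ⟨k, hk⟩ := t.hA.next _ _ (t.a4 h.2)
  exact ⟨k, mv hk (by simp; ring)⟩

theorem Trip.chB (t : Trip p q B M A) {y k} (h : comp p q M y k) :
    Chain q (p + q) B y (bB k) := by
  obtain ⟨hh, h⟩ := h
  have hb := t.hubB hh
  have hP := t.bm.hp
  have hM := t.bm.hM
  cases k <;> simp [Chain, bM, bB] at *
  · obtain ⟨m1, m2, m3⟩ := h
    have e := mv (b := y + q) (t.b3 m3) (by ring)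
    refine ⟨?_, e⟩
    rcases t.bm.hB.fill1 hP hb e rfl with h | h
    · exact h
    · exact (hM.kne hP (t.b2' h) m1 (by simp) rfl).elim
  · obtain ⟨m1, m2, m3⟩ := h
    exact ⟨t.b1 m1, mv (t.b3 m3) (by ring)⟩
  · obtain ⟨m1, m2, m3, m4, m5⟩ := h
    have e := mv (b := y + (p + q)) (t.b1 m3) (by ring)
    refine ⟨?_, e, mv (t.b3 m5) (by ring)⟩
    rcases t.bm.hB.fill3 hP hb e rfl with h | h
    · exact h
    · exact (hM.kne hP (t.b4' h) m2 (by simp) rfl).elim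
  · obtain ⟨m1, m2, m3, m4, m5⟩ := h
    exact ⟨mv (t.b3 m2) (by ring), mv (t.b1 m3) (by ring), mv (t.b3 m5) (by ring)⟩
  · obtain ⟨m1, m2, m3, m4, m5, m6⟩ := h
    have e1 := mv (b := y) (t.b3 m2) (by ring)
    have e := mv (b := y + (p + q) + q) (t.b1 m4) (by ring)
    refine ⟨e1, ?_, e, mv (t.b3 m6) (by ring)⟩
    rcases t.bm.hB.fill1 hP (t.bm.hB.next _ _ e1) e rfl with h | h
    · exact h
    · exact (hM.kne hP (t.b2' h) m3 (by simp) (by simp; ring)).elim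

theorem Trip.chA (t : Trip p q B M A) {y k} (h : comp p q M y k) :
    Chain q (p + q) A y (bA k) := by
  obtain ⟨hh, h⟩ := h
  have hb := t.hubA hh
  have hP := t.bm.hp
  have hM := t.bm.hM
  cases k <;> simp [Chain, bM, bA] at *
  · obtain ⟨m1, m2, m3⟩ := h
    exact ⟨t.a2 m1, mv (t.a4 m2) (by ring)⟩
  · obtain ⟨m1, m2, m3⟩ := h
    have e := mv (b := y + q) (t.a4 m2) (by ring)
    refine ⟨?_, e⟩
    rcases t.hA.fill1 hP hb e rfl with h | h
    · exact (hM.kne hP (t.a1' h) m1 (by simp) rfl).elim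
    · exact h
  · obtain ⟨m1, m2, m3, m4, m5⟩ := h
    exact ⟨t.a2 m1, mv (t.a4 m2) (by ring), mv (t.a4 m4) (by ring)⟩
  · obtain ⟨m1, m2, m3, m4, m5⟩ := h
    have e := mv (b := y + q + (p + q)) (t.a4 m4) (by ring)
    refine ⟨t.a2 m1, ?_, e⟩
    rcases t.hA.fill3 hP (t.hA.next _ _ (t.a2 m1)) e rfl with h | h
    · exact (hM.kne hP (t.a3' h) m2 (by simp) (by simp; ring)).elim
    · exact h
  · obtain ⟨m1, m2, m3, m4, m5, m6⟩ := h
    have e := mv (b := y + q + q) (t.a4 m3) (by ring)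
    refine ⟨t.a2 m1, ?_, e, mv (t.a4 m5) (by ring)⟩
    rcases t.hA.fill1 hP (t.hA.next _ _ (t.a2 m1)) e rfl with h | h
    · have h := t.a1' h
      have := hM.sp hP h m2
      obtain ⟨pa, pb, pc⟩ := hP
      simp at this
      omega
    · exact h

theorem Par.step3 (h : Par p q) : Par (p + 2 * q) (2 * p + 3 * q) := by
  obtain ⟨a, b, c⟩ := h
  constructor <;> omega

theorem Trip.compKind (t : Trip p q B M A) {y} (h : HHH q M y) : ∃ k, comp p q M y k := by
  rcases t.words h with a | a | a | a | a
  · exact ⟨k2, h, by simpa [bM, Chain] using a⟩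
  · exact ⟨k1, h, by simpa [bM, Chain] using a⟩
  · exact ⟨k3, h, by simpa [bM, Chain] using a⟩
  · exact ⟨k4, h, by simpa [bM, Chain] using a⟩
  · exact ⟨k5, h, by simpa [bM, Chain] using a⟩

theorem Trip.compRun (t : Trip p q B M A) :
    Run (p + 2 * q) (2 * p + 3 * q) (comp p q M) := by
  apply Run.mk' t.bm.hp.step3
  · intro z
    obtain ⟨y, hy, h⟩ := t.low z
    obtain ⟨k, hk⟩ := t.compKind h
    exact ⟨y, k, hy, hk⟩
  · intro x k h
    apply t.compKind
    obtain ⟨hh, h⟩ := h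
    cases k <;> simp [Chain, bM] at h
    · exact ⟨mv h.2.2 (by simp; ring), mv h.2.1 (by simp; ring)⟩
    · exact ⟨mv h.2.2 (by simp; ring), mv h.2.1 (by simp; ring)⟩
    · exact ⟨mv h.2.2.2.2 (by simp; ring), mv h.2.2.2.1 (by simp; ring)⟩
    · exact ⟨mv h.2.2.2.2 (by simp; ring), mv h.2.2.2.1 (by simp; ring)⟩
    · exact ⟨mv h.2.2.2.2.2 (by simp; ring), mv h.2.2.2.2.1 (by simp; ring)⟩
  · intro x k y k' hx hy h1 h2
    have hP := t.bm.hp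
    have hM := t.bm.hM
    have ⟨pa, pb, pc⟩ := hP
    have nn := fun {x y k k'} => @Run.kne _ _ _ hM hP x y k k'
    obtain ⟨hhx, hx⟩ := hx
    obtain ⟨⟨y3, y4⟩, hy⟩ := hy
    have hxy : x = y := by
      by_contra hne
      obtain ⟨j, hj⟩ := hM.next _ _ y3
      have hj := mv (b := y) hj (by simp; try ring)
      have i1 := hx.inC hM hj h1 (by rw [totM]; exact h2)
      cases k <;> simp [Chain, bM, InC] at hx i1
      · rcases i1 with i | i | i <;> have := hM.sp hP y3 hx.1 <;> have := hM.sp hP y3 hx.2.1 <;>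
          simp at * <;> omega
      · rcases i1 with i | i | i <;> have := hM.sp hP y3 hx.1 <;> have := hM.sp hP y3 hx.2.1 <;>
          simp at * <;> omega
      · obtain ⟨m1, m2, m3, m4, m5⟩ := hx
        rcases i1 with i | i | i | i | i <;> have := hM.sp hP y3 m1 <;> have := hM.sp hP y3 m2 <;>
          have := hM.sp hP y3 m3 <;> have := hM.sp hP y3 m4 <;> simp at * <;> omega
      · obtain ⟨m1, m2, m3, m4, m5⟩ := hx
        rcases i1 with i | i | i | i | i <;> have := hM.sp hP y3 m1 <;> have := hM.sp hP y4 m1 <;>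
          have := hM.sp hP y3 m3 <;> have := hM.sp hP y3 m4 <;> simp at * <;> omega
      · obtain ⟨m1, m2, m3, m4, m5, m6⟩ := hx
        rcases i1 with i | i | i | i | i | i <;> have := hM.sp hP y3 m1 <;> have := hM.sp hP y4 m1 <;>
          have := hM.sp hP y3 m3 <;> have := hM.sp hP y3 m4 <;> have := hM.sp hP y3 m5 <;>
          simp at * <;> omega
    subst hxy
    refine ⟨rfl, ?_⟩
    have f0 := fun {k k'} (h : M x k) (h' : M x k') (hk : k ≠ k') => nn h h' hk rfl
    have f1 := fun {k k'} (h : M (x + p) k) (h' : M (x + p) k') (hk : k ≠ k') => nn h h' hk rfl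
    have f2 := fun {k k'} (h : M (x + p + q) k) (h' : M (x + p + q) k') (hk : k ≠ k') => nn h h' hk rfl
    cases k <;> cases k' <;> simp [Chain, bM] at hx hy ⊢
    all_goals first
      | (refine f0 hx.1 hy.1 ?_; decide)
      | (refine f1 hx.2.1 hy.2.1 ?_; decide)
      | (refine f2 hx.2.2.1 hy.2.2.1 ?_; decide)
      | (refine f2 hx.2.2 hy.2.2.1 ?_; decide)
      | (refine f2 hx.2.2.1 hy.2.2 ?_; decide)

theorem Trip.dB (t : Trip p q B M A) : Dec q (p + q) B (comp p q M) bB :=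
  Dec.of t.bm.hp.step3 t.bm.hB t.compRun totB (fun _ _ h => t.chB h)
theorem Trip.dM (t : Trip p q B M A) : Dec p q M (comp p q M) bM :=
  Dec.of t.bm.hp.step3 t.bm.hM t.compRun totM (fun _ _ h => h.2)
theorem Trip.dA (t : Trip p q B M A) : Dec q (p + q) A (comp p q M) bA :=
  Dec.of t.bm.hp.step3 t.hA t.compRun totA (fun _ _ h => t.chA h)

variable {G : ℤ → K → Prop}

theorem Dec.in2B (h : Dec q (p + q) B G bB) (x) :
    in2 q (p + q) B x ↔ in2 (p + 2 * q) (2 * p + 3 * q) G x := by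
  unfold in2
  rw [h.B1, h.B5, show 2 * p + 3 * q - (p + 2 * q) = p + q by ring]
  simp
theorem Dec.in3B (h : Dec q (p + q) B G bB) (x) : in3 B x ↔ in3 G x := by
  unfold in3
  rw [h.B3]
theorem Dec.out2A (h : Dec q (p + q) A G bA) (x) :
    out2 q (p + q) A x ↔ out2 (p + 2 * q) (2 * p + 3 * q) G x := by
  unfold out2
  rw [h.A2, h.A5, show 2 * (p + 2 * q) - (2 * p + 3 * q) = q by ring]
  simp
theorem Dec.out3A (h : Dec q (p + q) A G bA) (x) :
    out3 q (p + q) A x ↔ out3 (p + 2 * q) (2 * p + 3 * q) G x := by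
  unfold out3
  rw [h.A4, show x - (p + q - q) - q = x - (2 * p + 3 * q - (p + 2 * q)) by ring]

theorem Dec.matchBM (h : Dec q (p + q) B G bB) (h' : Dec p q M G bM) :
    Match q (p + q) p q B M where
  m2 x := by
    unfold out2 in2
    rw [h.B2, h.B5, h'.M1, h'.M5]
  m3 x := by
    unfold out3 in3
    rw [h.B4, h'.M3]
    ring_nf

theorem Dec.matchMA (h : Dec p q M G bM) (h' : Dec q (p + q) A G bA) :
    Match p q q (p + q) M A where
  m2 x := by
    unfold out2 in2
    rw [h'.A1, h'.A5, h.M2, h.M5]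
  m3 x := by
    unfold out3 in3
    rw [h.M4, h'.A3]
    ring_nf

/-- No `1 0 1 0 1`. -/
theorem no_mid {M' A' : ℤ → K → Prop} (t : Trip p q B M A) (t' : Trip p q A M' A') : False := by
  have d := t.dA
  have d' := t'.dB
  have hP := t.bm.hp
  -- a `3` occurs in `A`
  have h3 : ∃ x, A x k3 := by
    obtain ⟨y, k, h⟩ := (t.compRun).ne
    have := t.chA h
    cases k <;> simp [Chain, bA] at this
    · exact ⟨_, this.2⟩
    · exact ⟨_, this.2⟩
    · exact ⟨_, this.2.2⟩
    · exact ⟨_, this.2.2⟩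
    · exact ⟨_, this.2.2.2⟩
  obtain ⟨x, hx⟩ := h3
  -- followed by `2 4`
  have h4 : A (x + (p + q)) k2 ∧ A (x + (p + q) + q) k4 := by
    have := t'.chB ((d'.B3 x).1 hx |> fun h => h)
    simp [Chain, bB] at this
    exact this.2
  -- but `2` is followed by `3`
  have h5 : A (x + (p + q) + q) k3 := by
    rcases (d.A2 _).1 h4.1 with h | h
    · have := t.chA h
      simp [Chain, bA] at this
      exact this.2
    · have := t.chA h
      simp [Chain, bA] at this
      exact mv this.2.2.1 (by ring)
  exact t.hA.kne hP.step h5 h4.2 (by simp) rfl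

end
end TDProof

namespace TDProof
open K
set_option linter.all false

/-- Widths. -/
def P : ℕ → ℤ
  | 0 => 5
  | 1 => 8
  | n + 2 => P n + P (n + 1)

/-- Heights. -/
def ht : ℕ → ℤ
  | 0 => 1
  | 1 => 2
  | 2 => 3
  | n + 3 => 2 * ht (n + 1) + ht n

theorem P_par : ∀ n, Par (P n) (P (n + 1))
  | 0 => by constructor <;> simp [P]
  | n + 1 => (P_par n).step

theorem ht_pos : ∀ n : ℕ, (n : ℤ) + 1 ≤ ht n
  | 0 => by simp [ht]
  | 1 => by simp [ht]
  | 2 => by simp [ht]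
  | n + 3 => by
    have := ht_pos n
    have := ht_pos (n + 1)
    push_cast at *
    simp only [ht]
    omega

/-- A run at level `n`. -/
abbrev RunL (n : ℕ) (H : ℤ → K → Prop) : Prop := Run (P n) (P (n + 1)) H

/-- Interfaces match up to a shift. -/
def MS (n m : ℕ) (B M : ℤ → K → Prop) : Prop :=
  ∃ s : ℤ, ∀ x, (out2 (P n) (P (n + 1)) B x ↔ in2 (P m) (P (m + 1)) M (x - s)) ∧
    (out3 (P n) (P (n + 1)) B x ↔ in3 M (x - s))

def SameIn (n m : ℕ) (B M : ℤ → K → Prop) : Prop :=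
  ∃ s : ℤ, ∀ x, (in2 (P n) (P (n + 1)) B x ↔ in2 (P m) (P (m + 1)) M (x - s)) ∧
    (in3 B x ↔ in3 M (x - s))

def SameOut (n m : ℕ) (B M : ℤ → K → Prop) : Prop :=
  ∃ s : ℤ, ∀ x, (out2 (P n) (P (n + 1)) B x ↔ out2 (P m) (P (m + 1)) M (x - s)) ∧
    (out3 (P n) (P (n + 1)) B x ↔ out3 (P m) (P (m + 1)) M (x - s))

theorem MS.trans_in {n m l B M G} (h : MS n m B M) (h' : SameIn m l M G) : MS n l B G := by
  obtain ⟨s, h⟩ := h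
  obtain ⟨s', h'⟩ := h'
  refine ⟨s + s', fun x => ?_⟩
  rw [(h x).1, (h x).2, (h' _).1, (h' _).2, sub_sub]
  exact ⟨Iff.rfl, Iff.rfl⟩

theorem MS.trans_out {n m l B M G} (h' : SameOut n m G B) (h : MS m l B M) : MS n l G M := by
  obtain ⟨s, h⟩ := h
  obtain ⟨s', h'⟩ := h'
  refine ⟨s' + s, fun x => ?_⟩
  rw [(h' x).1, (h' x).2, (h _).1, (h _).2, sub_sub]
  exact ⟨Iff.rfl, Iff.rfl⟩

theorem MS.toMatch {n m B M} (h : MS n m B M) :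
    ∃ s, Match (P n) (P (n + 1)) (P m) (P (m + 1)) B (fun x k => M (x - s) k) := by
  obtain ⟨s, h⟩ := h
  refine ⟨s, ⟨fun x => ?_, fun x => (h x).2⟩⟩
  rw [(h x).1]
  unfold in2
  rw [show x - s - (P (m + 1) - P m) = x - (P (m + 1) - P m) - s by ring]

theorem MS.shiftL {n m B M} (h : MS n m B M) (s : ℤ) : MS n m (fun x k => B (x - s) k) M := by
  obtain ⟨t, h⟩ := h
  refine ⟨s + t, fun x => ?_⟩
  have := h (x - s)
  rw [← sub_sub]
  refine ⟨?_, ?_⟩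
  · rw [← this.1]; unfold out2
    rw [show x - s - (2 * P n - P (n + 1)) = x - (2 * P n - P (n + 1)) - s by ring]
  · rw [← this.2]; unfold out3
    rw [show x - s - (P (n + 1) - P n) = x - (P (n + 1) - P n) - s by ring]

theorem mkTrip {n B M A} (hB : RunL (n + 1) B) (hM : RunL n M) (hA : RunL (n + 1) A)
    (h1 : MS (n + 1) n B M) (h2 : MS n (n + 1) M A) :
    ∃ s s', Trip (P n) (P (n + 1)) B (fun x k => M (x - s) k) (fun x k => A (x - s') k) := by
  obtain ⟨s, m1⟩ := h1.toMatch
  obtain ⟨s', m2⟩ := (h2.shiftL s).toMatch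
  exact ⟨s, s', ⟨⟨P_par n, hB, hM.shift s, m1⟩, hA.shift s', m2⟩⟩

theorem compose {n B M A} (hB : RunL (n + 1) B) (hM : RunL n M) (hA : RunL (n + 1) A)
    (h1 : MS (n + 1) n B M) (h2 : MS n (n + 1) M A) :
    ∃ G, RunL (n + 3) G ∧ SameIn (n + 1) (n + 3) B G ∧ SameOut (n + 3) (n + 1) G A := by
  obtain ⟨s, s', t⟩ := mkTrip hB hM hA h1 h2
  have e3 : P (n + 3) = P n + 2 * P (n + 1) := by simp only [P]; ring
  have e4 : P (n + 3 + 1) = 2 * P n + 3 * P (n + 1) := by simp only [P]; ring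
  refine ⟨comp (P n) (P (n + 1)) (fun x k => M (x - s) k), ?_, ⟨0, ?_⟩, ⟨s', ?_⟩⟩
  · unfold RunL; rw [e3, e4]; exact t.compRun
  · intro x
    rw [e3, e4, sub_zero]
    exact ⟨t.dB.in2B x, t.dB.in3B x⟩
  · intro x
    rw [e3, e4]
    refine ⟨(t.dA.out2A x).symm.trans ?_, (t.dA.out3A x).symm.trans ?_⟩
    · unfold out2
      rw [show P (n + 1 + 1) = P n + P (n + 1) from rfl]
      ring_nf
    · unfold out3
      rw [show P (n + 1 + 1) = P n + P (n + 1) from rfl]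
      ring_nf

theorem no_mid' {n B M A M' A'} (hB : RunL (n + 1) B) (hM : RunL n M) (hA : RunL (n + 1) A)
    (hM' : RunL n M') (hA' : RunL (n + 1) A')
    (h1 : MS (n + 1) n B M) (h2 : MS n (n + 1) M A) (h3 : MS (n + 1) n A M')
    (h4 : MS n (n + 1) M' A') : False := by
  obtain ⟨s, s', t⟩ := mkTrip hB hM hA h1 h2
  obtain ⟨u, u', t'⟩ := mkTrip (t.hA) hM' hA' (h3.shiftL s') h4
  exact no_mid t t'

/-- A stacking of row-blocks of levels `n`, `n+1`, `n+2`. -/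
structure Lev (n : ℕ) (V0 V1 V2 : ℤ → Prop) : Prop where
  ne : ∃ y, V0 y ∨ V1 y ∨ V2 y
  n0 : ∀ y, V0 y → V1 (y + ht n)
  n1 : ∀ y, V1 y → V0 (y + ht (n + 1)) ∨ V2 (y + ht (n + 1))
  n2 : ∀ y, V2 y → V1 (y + ht (n + 2))
  s0 : ∀ y z, V0 y → y < z → z < y + ht n → ¬ V0 z ∧ ¬ V1 z ∧ ¬ V2 z
  s1 : ∀ y z, V1 y → y < z → z < y + ht (n + 1) → ¬ V0 z ∧ ¬ V1 z ∧ ¬ V2 z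
  s2 : ∀ y z, V2 y → y < z → z < y + ht (n + 2) → ¬ V0 z ∧ ¬ V1 z ∧ ¬ V2 z
  d01 : ∀ y, V0 y → ¬ V1 y
  d02 : ∀ y, V0 y → ¬ V2 y
  d12 : ∀ y, V1 y → ¬ V2 y
  rows : ∃ H : ℤ → ℤ → K → Prop,
    (∀ y, V0 y → RunL n (H y) ∧ MS n (n + 1) (H y) (H (y + ht n))) ∧
    (∀ y, V2 y → RunL (n + 2) (H y) ∧ MS (n + 2) (n + 1) (H y) (H (y + ht (n + 2)))) ∧
    (∀ y, V1 y → RunL (n + 1) (H y) ∧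
      (V0 (y + ht (n + 1)) → MS (n + 1) n (H y) (H (y + ht (n + 1)))) ∧
      (V2 (y + ht (n + 1)) → MS (n + 1) (n + 2) (H y) (H (y + ht (n + 1)))))

theorem Lev.noM {n V0 V1 V2} (h : Lev n V0 V1 V2) {y} (h1 : V1 y) (h0 : V0 (y + ht (n + 1)))
    (h0' : V0 (y + ht (n + 1) + ht n + ht (n + 1))) : False := by
  obtain ⟨H, r0, r2, r1⟩ := h.rows
  have a := h.n0 _ h0
  have b := h.n0 _ h0'
  exact no_mid' (r1 _ h1).1 (r0 _ h0).1 (r1 _ a).1 (r0 _ h0').1 (r1 _ b).1 ((r1 _ h1).2.1 h0)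
    (r0 _ h0).2 ((r1 _ a).2.1 h0') (r0 _ h0').2

def U2 (n : ℕ) (V0 V1 : ℤ → Prop) (y : ℤ) : Prop := V1 y ∧ V0 (y + ht (n + 1))
def U0 (n : ℕ) (V0 V1 : ℤ → Prop) (y : ℤ) : Prop :=
  V1 y ∧ ¬ V0 (y + ht (n + 1)) ∧ ¬ V0 (y - ht n)

theorem Lev.step {n V0 V1 V2} (h : Lev n V0 V1 V2) :
    Lev (n + 1) (U0 n V0 V1) V2 (U2 n V0 V1) := by
  have e0 := ht_pos n
  have e1 := ht_pos (n + 1)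
  have e2 := ht_pos (n + 2)
  have e3 : ht (n + 1 + 2) = 2 * ht (n + 1) + ht n := rfl
  have mono : ht n < ht (n + 2) := by
    clear e0 e1 e2 e3 h
    induction n using Nat.strong_induction_on with
    | _ n ih =>
      match n with
      | 0 => simp [ht]
      | 1 => simp [ht]
      | 2 => simp [ht]
      | n + 3 =>
        have := ih n (by omega)
        have := ih (n + 1) (by omega)
        have := ih (n + 2) (by omega)
        simp only [ht] at *
        omega
  have key : ∀ y, U2 n V0 V1 y → V2 (y + (2 * ht (n + 1) + ht n)) := by
    rintro y ⟨a, b⟩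
    have c := h.n0 _ b
    rcases h.n1 _ c with d | d
    · exact (h.noM a b d).elim
    · convert d using 1; ring
  obtain ⟨H, r0, r2, r1⟩ := h.rows
  have U2s : ∀ y z, U2 n V0 V1 y → y < z → z < y + ht (n + 1 + 2) →
      ¬ U0 n V0 V1 z ∧ ¬ V2 z ∧ ¬ U2 n V0 V1 z := by
    rintro y z ⟨a, b⟩ h1 h2
    have c := h.n0 _ b
    have t1 := h.s1 _ z a h1
    have t2 := h.s0 _ z b
    have t3 := h.s1 _ z c
    rcases lt_trichotomy z (y + ht (n + 1)) with g | g | g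
    · have := t1 g
      exact ⟨fun k => this.2.1 k.1, this.2.2, fun k => this.2.1 k.1⟩
    · subst g
      exact ⟨fun k => h.d01 _ b k.1, h.d02 _ b, fun k => h.d01 _ b k.1⟩
    · rcases lt_trichotomy z (y + ht (n + 1) + ht n) with g' | g' | g'
      · have := t2 g g'
        exact ⟨fun k => this.2.1 k.1, this.2.2, fun k => this.2.1 k.1⟩
      · subst g'
        refine ⟨fun k => k.2.2 (by convert b using 1; ring), h.d12 _ c, fun k => h.noM a b k.2⟩
      · have := t3 g' (by omega)
        exact ⟨fun k => this.2.1 k.1, this.2.2, fun k => this.2.1 k.1⟩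
  refine ⟨?_, ?_, ?_, ?_, ?_, ?_, ?_, ?_, ?_, ?_, ?_⟩
  · have : ∃ y, V1 y := by
      obtain ⟨y, h1 | h1 | h1⟩ := h.ne
      · exact ⟨_, h.n0 _ h1⟩
      · exact ⟨_, h1⟩
      · exact ⟨_, h.n2 _ h1⟩
    obtain ⟨y, hy⟩ := this
    rcases h.n1 _ hy with h0 | h2
    · exact ⟨y, Or.inr (Or.inr ⟨hy, h0⟩)⟩
    · exact ⟨_, Or.inr (Or.inl h2)⟩
  · rintro y ⟨a, b, c⟩
    rcases h.n1 _ a with d | d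
    · exact (b d).elim
    · exact d
  · intro y a
    have b := h.n2 _ a
    rw [show n + 1 + 1 = n + 2 from rfl]
    by_cases c : V0 (y + ht (n + 2) + ht (n + 1))
    · exact Or.inr ⟨b, c⟩
    · refine Or.inl ⟨b, c, fun d => ?_⟩
      exact (h.s2 y _ a (by omega) (by push_cast at *; omega)).1 d
  · intro y a
    exact key y a
  · rintro y z ⟨a, b, c⟩ h1 h2
    have := h.s1 _ z a h1 h2
    exact ⟨fun k => this.2.1 k.1, this.2.2, fun k => this.2.1 k.1⟩
  · rintro y z a h1 h2
    have := h.s2 _ z a h1 h2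
    exact ⟨fun k => this.2.1 k.1, this.2.2, fun k => this.2.1 k.1⟩
  · exact U2s
  · exact fun y a b => h.d12 _ a.1 b
  · exact fun y a b => a.2.1 b.2
  · exact fun y a b => h.d12 _ b.1 a
  · have ex : ∀ y, ∃ G, (U2 n V0 V1 y → RunL (n + 3) G ∧ SameIn (n + 1) (n + 3) (H y) G ∧
        SameOut (n + 3) (n + 1) G (H (y + ht (n + 1) + ht n))) ∧ (¬ U2 n V0 V1 y → G = H y) := by
      intro y
      by_cases hy : U2 n V0 V1 y
      · obtain ⟨a, b⟩ := hy
        have c := h.n0 _ b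
        obtain ⟨G, hG⟩ := compose (r1 _ a).1 (r0 _ b).1 (r1 _ c).1 ((r1 _ a).2.1 b) (r0 _ b).2
        exact ⟨G, fun _ => hG, fun k => (k ⟨a, b⟩).elim⟩
      · exact ⟨H y, fun k => (hy k).elim, fun _ => rfl⟩
    choose G hG hG' using ex
    have g2 : ∀ y, V2 y → G y = H y := fun y hy => hG' y (fun k => h.d12 _ k.1 hy)
    have g0 : ∀ y, U0 n V0 V1 y → G y = H y := fun y hy => hG' y (fun k => hy.2.1 k.2)
    refine ⟨G, ?_, ?_, ?_⟩
    · intro y hy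
      have v : V2 (y + ht (n + 1)) := by
        rcases h.n1 _ hy.1 with d | d
        · exact (hy.2.1 d).elim
        · exact d
      rw [g0 y hy, g2 _ v]
      exact ⟨(r1 _ hy.1).1, (r1 _ hy.1).2.2 v⟩
    · intro y hy
      have v := key y hy
      obtain ⟨a, b, c⟩ := hG y hy
      rw [e3, g2 _ v]
      refine ⟨a, MS.trans_out c ?_⟩
      have d := h.n0 _ hy.2
      have := (r1 _ d).2.2 (by convert v using 1; ring)
      convert this using 2; ring
    · intro y hy
      rw [g2 _ hy]
      refine ⟨(r2 _ hy).1, fun k => ?_, fun k => ?_⟩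
      · rw [g0 _ k]; exact (r2 _ hy).2
      · exact (r2 _ hy).2.trans_in (hG _ k).2.1

theorem Lev.aper {v : ℤ} (hv : 0 < v) : ∀ (N n : ℕ), v ≤ n + N → ∀ {V0 V1 V2}, Lev n V0 V1 V2 →
    (∀ y, V0 (y + v) ↔ V0 y) → (∀ y, V1 (y + v) ↔ V1 y) → (∀ y, V2 (y + v) ↔ V2 y) → False
  | 0, n, hN, V0, V1, V2, h, p0, p1, p2 => by
    have e0 := ht_pos n
    have e1 := ht_pos (n + 1)
    have e2 := ht_pos (n + 2)
    push_cast at *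
    obtain ⟨y, h1 | h1 | h1⟩ := h.ne
    · exact (h.s0 _ (y + v) h1 (by omega) (by omega)).1 ((p0 y).2 h1)
    · exact (h.s1 _ (y + v) h1 (by omega) (by omega)).2.1 ((p1 y).2 h1)
    · exact (h.s2 _ (y + v) h1 (by omega) (by omega)).2.2 ((p2 y).2 h1)
  | N + 1, n, hN, V0, V1, V2, h, p0, p1, p2 => by
    refine Lev.aper hv N (n + 1) (by push_cast at *; omega) h.step ?_ p2 ?_
    · intro y
      unfold U0
      rw [p1, show y + v + ht (n + 1) = y + ht (n + 1) + v by ring,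
        show y + v - ht n = y - ht n + v by ring, p0, p0]
    · intro y
      unfold U2
      rw [p1, show y + v + ht (n + 1) = y + ht (n + 1) + v by ring, p0]
end TDProof

namespace TDProof
open K
set_option linter.all false
noncomputable section
structure Ed where
  s : ℕ
  t : ℕ
  i : ℕ
  o : ℕ
deriving DecidableEq
def anyL {α : Type} (p : α → Bool) (l : List α) : Bool :=
  List.rec (motive := fun _ => Bool) false (fun a _ ih => Bool.rec ih true (p a)) l
def filL {α : Type} (p : α → Bool) (l : List α) : List α :=
  List.rec (motive := fun _ => List α) [] (fun a _ ih => Bool.rec ih (a :: ih) (p a)) l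
def foldL {α β : Type} (p : α → β → β) (b : β) (l : List α) : β :=
  List.rec (motive := fun _ => β) b (fun a _ ih => p a ih) l
def bkts (N : ℕ) (E : List Ed) (g : Ed → ℕ) : List (List Ed) :=
  Nat.rec (motive := fun _ => List (List Ed)) [] (fun c ih => filL (fun f => Nat.beq (Nat.mod (g f) N) c) E :: ih) N
def nthL (l : List (List Ed)) : ℕ → List Ed :=
  List.rec (motive := fun _ => ℕ → List Ed) (fun _ => []) (fun a _ ih n =>
    Nat.rec (motive := fun _ => List Ed) a (fun m _ => ih m) n) l
def trimA (N : ℕ) (E : List Ed) (bt bs : List (List Ed)) : List Ed :=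
  filL (fun e => Bool.rec false (anyL (fun f => Nat.beq f.s e.t) (nthL bs (Nat.sub (Nat.sub N 1) (Nat.mod e.t N))))
   (anyL (fun f => Nat.beq f.t e.s) (nthL bt (Nat.sub (Nat.sub N 1) (Nat.mod e.s N))))) E
def trim (E : List Ed) : List Ed := trimA 15 E (bkts 15 E Ed.t) (bkts 15 E Ed.s)
def trims (n : ℕ) : List Ed → List Ed :=
  Nat.rec (motive := fun _ => List Ed → List Ed) (fun E => E) (fun _ ih E => ih (trim E)) n
def mulE (e f : Ed) : Ed := ⟨e.s * 20 + f.s, e.t * 20 + f.t, e.i, f.o⟩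
def fz (n : ℕ) (k : ℕ → List Ed) : List Ed := Nat.rec (motive := fun _ => List Ed) (k 0) (fun m _ => k m) (Nat.succ n)
def pushE (a b c d : ℕ) (l : List Ed) : List Ed :=
  fz a (fun a => fz b (fun b => fz c (fun c => fz d (fun d => ⟨a,b,c,d⟩ :: l))))
def cmp (E F : List Ed) : List Ed :=
  foldL (fun e acc => foldL (fun f acc => Bool.rec acc 
    (pushE (e.s * 20 + f.s) (e.t * 20 + f.t) e.i f.o acc) (Nat.beq e.o f.i)) acc F) [] E

def LA : List Ed := [⟨0,1,1,0⟩, ⟨5,1,1,1⟩, ⟨6,0,1,1⟩, ⟨4,5,1,1⟩, ⟨2,3,1,0⟩, ⟨1,2,1,0⟩, ⟨1,6,1,1⟩,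
  ⟨3,4,1,1⟩, ⟨8,9,0,0⟩, ⟨2,8,0,0⟩, ⟨3,7,0,0⟩, ⟨9,0,0,0⟩, ⟨7,2,0,0⟩, ⟨7,6,0,1⟩]
def LB : List Ed := [⟨17,19,1,1⟩, ⟨13,10,1,1⟩, ⟨19,12,1,1⟩, ⟨19,13,1,1⟩, ⟨18,16,0,0⟩, ⟨14,15,0,1⟩,
  ⟨17,18,0,1⟩, ⟨12,14,0,1⟩, ⟨19,11,0,0⟩, ⟨10,11,0,1⟩, ⟨15,19,0,0⟩, ⟨15,17,0,1⟩, ⟨11,12,0,1⟩,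
  ⟨16,19,0,0⟩]


def jn (E F : List Ed) : List Ed :=
  foldL (fun e acc => foldL (fun f acc => Bool.rec acc
    (Bool.rec acc (pushE (e.s * 8000 + f.s) (e.t * 8000 + f.t) e.i f.o acc)
      (Nat.beq (Nat.mod e.t 20) (Nat.div f.t 400)))
      (Nat.beq (Nat.mod e.s 20) (Nat.div f.s 400))) acc F) [] E

/-- Trimmed edges of two consecutive rows of type `a`. -/
def AA : List Ed := [⟨2,28,1,0⟩, ⟨9,20,1,0⟩, ⟨106,20,1,1⟩, ⟨104,25,1,1⟩, ⟨102,23,1,0⟩, ⟨101,22,1,0⟩, ⟨121,2,1,0⟩, 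
  ⟨80,101,1,0⟩, ⟨81,102,1,0⟩, ⟨81,106,1,1⟩, ⟨83,104,1,1⟩, ⟨48,69,1,0⟩, ⟨49,60,1,0⟩, ⟨47,62,1,0⟩, 
  ⟨47,66,1,1⟩, ⟨28,49,1,0⟩, ⟨22,48,1,0⟩, ⟨23,47,1,0⟩, ⟨20,121,1,0⟩, ⟨25,121,1,1⟩, ⟨60,81,1,0⟩, 
  ⟨66,80,1,1⟩, ⟨62,83,1,0⟩, ⟨162,188,0,0⟩, ⟨47,162,0,0⟩, ⟨62,148,0,0⟩, ⟨69,140,0,0⟩, ⟨188,9,0,0⟩, 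
  ⟨148,49,0,0⟩, ⟨140,121,0,0⟩]

/-- Trimmed edges of three consecutive rows of types `b`, `a`, `b`. -/
def BAB : List Ed := [⟨6899,7713,1,1⟩, ⟨6834,7655,1,1⟩, ⟨5277,4099,1,1⟩, ⟨7713,4830,1,1⟩, ⟨7655,4877,1,1⟩, 
  ⟨7655,5277,1,1⟩, ⟨7255,6579,0,0⟩, ⟨7255,6577,0,1⟩, ⟨7251,6572,0,1⟩, ⟨5739,6012,0,1⟩, 
  ⟨5699,6113,0,1⟩, ⟨5655,6077,0,1⟩, ⟨5651,6072,0,1⟩, ⟨6834,7255,0,1⟩, ⟨6830,7251,0,1⟩, 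
  ⟨4834,5655,0,1⟩, ⟨4839,5651,0,0⟩, ⟨4830,5651,0,1⟩, ⟨4837,5739,0,1⟩, ⟨4877,5699,0,1⟩, 
  ⟨7798,4416,0,0⟩, ⟨7794,4415,0,1⟩, ⟨7791,4412,0,1⟩, ⟨7754,4455,0,1⟩, ⟨4099,4513,0,1⟩, 
  ⟨6072,7754,0,1⟩, ⟨6012,6834,0,1⟩, ⟨6113,6830,0,1⟩, ⟨6077,6899,0,1⟩, ⟨4412,4834,0,1⟩, 
  ⟨4415,4839,0,0⟩, ⟨4415,4837,0,1⟩, ⟨4416,4839,0,0⟩, ⟨4513,4830,0,1⟩, ⟨4455,4877,0,1⟩, 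
  ⟨6577,7798,0,1⟩, ⟨6572,7794,0,1⟩, ⟨6579,7791,0,0⟩]

theorem bb_nil : trims 6 (cmp LB LB) = [] := by decide +kernel
theorem aa_eq : trims 6 (cmp LA LA) = AA := by decide +kernel
theorem aaa_nil : trims 10 (cmp AA LA) = [] := by decide +kernel
theorem bab_eq : trims 13 (cmp (trims 3 (cmp LB LA)) LB) = BAB := by decide +kernel
theorem babab_nil : trims 17 (jn BAB BAB) = [] := by decide +kernel

theorem anyL_iff {α : Type} (p : α → Bool) (l : List α) : anyL p l = true ↔ ∃ a ∈ l, p a = true := by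
  induction l with
  | nil => simp [anyL]
  | cons a l ih =>
    have : anyL p (a :: l) = Bool.rec (anyL p l) true (p a) := rfl
    rw [this]
    cases h : p a <;> simp [h, ih]

theorem mem_filL {α : Type} (p : α → Bool) (l : List α) (x : α) : x ∈ filL p l ↔ x ∈ l ∧ p x = true := by
  induction l with
  | nil => simp [filL]
  | cons a l ih =>
    have : filL p (a :: l) = Bool.rec (filL p l) (a :: filL p l) (p a) := rfl
    rw [this]
    cases h : p a <;> simp [ih] <;> grind

theorem nth_bkts (N : ℕ) (E : List Ed) (g : Ed → ℕ) (M c : ℕ) (h : c < M) :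
    nthL (Nat.rec (motive := fun _ => List (List Ed)) []
      (fun c ih => filL (fun f => Nat.beq (Nat.mod (g f) N) c) E :: ih) M) (M - 1 - c) =
    filL (fun f => Nat.beq (Nat.mod (g f) N) c) E := by
  induction M with
  | zero => omega
  | succ M ih =>
    by_cases hc : c = M
    · subst hc
      simp
      rfl
    · have : M + 1 - 1 - c = (M - 1 - c) + 1 := by omega
      rw [this]
      exact ih (by omega)

/-- A bi-infinite path using the given edges. -/
structure IsPath (E : List Ed) (e : ℤ → Ed) : Prop where
  mem : ∀ x, e x ∈ E
  lk : ∀ x, (e x).t = (e (x + 1)).s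

theorem IsPath.trim {E e} (h : IsPath E e) : IsPath (trim E) e := by
  refine ⟨fun x => ?_, h.lk⟩
  unfold TDProof.trim trimA
  rw [mem_filL]
  refine ⟨h.mem x, ?_⟩
  have hx : (e x).s % 15 < 15 := Nat.mod_lt _ (by norm_num)
  have hx' : (e x).t % 15 < 15 := Nat.mod_lt _ (by norm_num)
  have a1 : anyL (fun f => Nat.beq f.t (e x).s) (nthL (bkts 15 E Ed.t) (Nat.sub (Nat.sub 15 1) (Nat.mod (e x).s 15))) = true := by
    rw [anyL_iff]
    refine ⟨e (x - 1), ?_, ?_⟩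
    · have := nth_bkts 15 E Ed.t 15 _ hx
      have h2 := (mem_filL (fun f => Nat.beq (Nat.mod (Ed.t f) 15) ((e x).s % 15)) E (e (x - 1))).2
        ⟨h.mem _, by have := h.lk (x - 1); simp at this; simp [this]; rfl⟩
      rw [← this] at h2
      exact h2
    · have := h.lk (x - 1); simp at this; simp [this]
  have a2 : anyL (fun f => Nat.beq f.s (e x).t) (nthL (bkts 15 E Ed.s) (Nat.sub (Nat.sub 15 1) (Nat.mod (e x).t 15))) = true := by
    rw [anyL_iff]
    refine ⟨e (x + 1), ?_, ?_⟩
    · have := nth_bkts 15 E Ed.s 15 _ hx'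
      have h2 := (mem_filL (fun f => Nat.beq (Nat.mod (Ed.s f) 15) ((e x).t % 15)) E (e (x + 1))).2
        ⟨h.mem _, by have := h.lk x; simp [this]; rfl⟩
      rw [← this] at h2
      exact h2
    · have := h.lk x; simp [this]
  rw [a1, a2]

theorem IsPath.trims {E e} (h : IsPath E e) (n : ℕ) : IsPath (trims n E) e := by
  induction n generalizing E with
  | zero => exact h
  | succ n ih => exact ih h.trim

theorem pushE_eq (a b c d l) : pushE a b c d l = ⟨a, b, c, d⟩ :: l := rfl

theorem mem_foldL {α β : Type} (p : α → List β → List β) (x : β) (l : List α) (acc : List β)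
    (mono : ∀ a acc, x ∈ acc → x ∈ p a acc)
    (h : x ∈ acc ∨ ∃ a ∈ l, ∀ acc, x ∈ p a acc) : x ∈ foldL p acc l := by
  induction l with
  | nil => simpa [foldL] using h
  | cons a l ih =>
    change x ∈ p a (foldL p acc l)
    rcases h with h | ⟨b, hb, h⟩
    · exact mono _ _ (ih (Or.inl h))
    · rcases List.mem_cons.1 hb with rfl | hb
      · exact h _
      · exact mono _ _ (ih (Or.inr ⟨b, hb, h⟩))

theorem foldL_mono {α β : Type} (p : α → List β → List β) (x : β) (l : List α) (acc : List β)
    (mono : ∀ a acc, x ∈ acc → x ∈ p a acc) (h : x ∈ acc) : x ∈ foldL p acc l :=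
  mem_foldL p x l acc mono (Or.inl h)

theorem mem_cmp {E F : List Ed} {e f : Ed} (he : e ∈ E) (hf : f ∈ F) (h : e.o = f.i) :
    mulE e f ∈ cmp E F := by
  have m1 : ∀ x e f : Ed, ∀ acc : List Ed, x ∈ acc → x ∈ (Bool.rec acc
    (pushE (e.s * 20 + f.s) (e.t * 20 + f.t) e.i f.o acc) (Nat.beq e.o f.i) : List Ed) := by
    intro x e f acc hx
    cases Nat.beq e.o f.i
    · exact hx
    · exact List.mem_cons_of_mem _ hx
  refine mem_foldL _ _ _ _ (fun a acc hx => foldL_mono _ _ _ _ (fun b acc hx => m1 _ _ _ _ hx) hx)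
    (Or.inr ⟨e, he, fun acc => ?_⟩)
  refine mem_foldL _ _ _ _ (fun b acc hx => m1 _ _ _ _ hx) (Or.inr ⟨f, hf, fun acc => ?_⟩)
  have : Nat.beq e.o f.i = true := by simp [h]
  rw [this]
  exact List.mem_cons_self

theorem mem_jn {E F : List Ed} {e f : Ed} (he : e ∈ E) (hf : f ∈ F) (h : e.s % 20 = f.s / 400)
    (h' : e.t % 20 = f.t / 400) :
    (⟨e.s * 8000 + f.s, e.t * 8000 + f.t, e.i, f.o⟩ : Ed) ∈ jn E F := by
  have m1 : ∀ x e f : Ed, ∀ acc : List Ed, x ∈ acc → x ∈ (Bool.rec acc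
    (Bool.rec acc (pushE (e.s * 8000 + f.s) (e.t * 8000 + f.t) e.i f.o acc)
      (Nat.beq (Nat.mod e.t 20) (Nat.div f.t 400)))
      (Nat.beq (Nat.mod e.s 20) (Nat.div f.s 400)) : List Ed) := by
    intro x e f acc hx
    cases Nat.beq (Nat.mod e.s 20) (Nat.div f.s 400)
    · exact hx
    · cases Nat.beq (Nat.mod e.t 20) (Nat.div f.t 400)
      · exact hx
      · exact List.mem_cons_of_mem _ hx
  refine mem_foldL _ _ _ _ (fun a acc hx => foldL_mono _ _ _ _ (fun b acc hx => m1 _ _ _ _ hx) hx)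
    (Or.inr ⟨e, he, fun acc => ?_⟩)
  refine mem_foldL _ _ _ _ (fun b acc hx => m1 _ _ _ _ hx) (Or.inr ⟨f, hf, fun acc => ?_⟩)
  have h1 : Nat.beq (Nat.mod e.s 20) (Nat.div f.s 400) = true := Nat.beq_eq ▸ h
  have h2 : Nat.beq (Nat.mod e.t 20) (Nat.div f.t 400) = true := Nat.beq_eq ▸ h'
  rw [h1, h2]
  exact List.mem_cons_self

theorem IsPath.cmp {E F e f} (h : IsPath E e) (h' : IsPath F f) (ho : ∀ x, (e x).o = (f x).i) :
    IsPath (cmp E F) (fun x => mulE (e x) (f x)) where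
  mem x := mem_cmp (h.mem x) (h'.mem x) (ho x)
  lk x := by simp [mulE, h.lk, h'.lk]

theorem IsPath.nil {e} (h : IsPath [] e) : False := by
  have := h.mem 0
  simp at this

theorem no_bb {e f} (h : IsPath LB e) (h' : IsPath LB f) (ho : ∀ x, (e x).o = (f x).i) : False :=
  IsPath.nil (bb_nil ▸ (h.cmp h' ho).trims 6)

theorem pathAA {e f} (h : IsPath LA e) (h' : IsPath LA f) (ho : ∀ x, (e x).o = (f x).i) :
    IsPath AA (fun x => mulE (e x) (f x)) :=
  aa_eq ▸ (h.cmp h' ho).trims 6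

theorem no_aaa {e f g} (h : IsPath LA e) (h' : IsPath LA f) (hg : IsPath LA g)
    (ho : ∀ x, (e x).o = (f x).i) (ho' : ∀ x, (f x).o = (g x).i) : False :=
  IsPath.nil (aaa_nil ▸ ((pathAA h h' ho).cmp hg ho').trims 10)

theorem pathBAB {e f g} (h : IsPath LB e) (h' : IsPath LA f) (hg : IsPath LB g)
    (ho : ∀ x, (e x).o = (f x).i) (ho' : ∀ x, (f x).o = (g x).i) :
    IsPath BAB (fun x => mulE (mulE (e x) (f x)) (g x)) :=
  bab_eq ▸ (((h.cmp h' ho).trims 3).cmp hg ho').trims 13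

theorem LA_lt : ∀ e ∈ LA, e.s < 20 ∧ e.t < 20 := by decide
theorem LB_lt : ∀ e ∈ LB, e.s < 20 ∧ e.t < 20 := by decide

theorem no_babab {e f g e' f'} (h : IsPath LB e) (h' : IsPath LA f) (hg : IsPath LB g)
    (he : IsPath LA e') (hf : IsPath LB f')
    (ho : ∀ x, (e x).o = (f x).i) (ho' : ∀ x, (f x).o = (g x).i) (ho2 : ∀ x, (g x).o = (e' x).i)
    (ho3 : ∀ x, (e' x).o = (f' x).i) : False := by
  have a := pathBAB h h' hg ho ho'
  have b := pathBAB hg he hf ho2 ho3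
  have c : IsPath (jn BAB BAB) (fun x => ⟨(mulE (mulE (e x) (f x)) (g x)).s * 8000 +
      (mulE (mulE (g x) (e' x)) (f' x)).s, (mulE (mulE (e x) (f x)) (g x)).t * 8000 +
      (mulE (mulE (g x) (e' x)) (f' x)).t, (mulE (mulE (e x) (f x)) (g x)).i,
      (mulE (mulE (g x) (e' x)) (f' x)).o⟩) := by
    refine ⟨fun x => mem_jn (a.mem x) (b.mem x) ?_ ?_, fun x => ?_⟩
    · have := LB_lt _ (hg.mem x)
      have := LA_lt _ (he.mem x)
      have := LB_lt _ (hf.mem x)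
      simp only [mulE]
      omega
    · have := LB_lt _ (hg.mem x)
      have := LA_lt _ (he.mem x)
      have := LB_lt _ (hf.mem x)
      simp only [mulE]
      omega
    · have := a.lk x
      have := b.lk x
      simp only at *
      omega
  exact IsPath.nil (babab_nil ▸ c.trims 17)
end
end TDProof

namespace TDProof
open K
set_option linter.all false
noncomputable section

/-- Window of a path. -/
def win (e : ℤ → Ed) : ℤ → ℕ → List Ed
  | _, 0 => []
  | x, n + 1 => e x :: win e (x + 1) n

def okW (gd : Ed → Ed → Ed → Bool) (e : Ed) (w : List Ed) : Bool :=
  List.rec (motive := fun _ => Bool) true (fun f w' _ =>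
    List.rec (motive := fun _ => Bool) true (fun g _ _ => gd e f g) w') w

/-- All paths of a given length from a state. -/
def pth (E : List Ed) (gd : Ed → Ed → Ed → Bool) (n : ℕ) : ℕ → List (List Ed) :=
  Nat.rec (motive := fun _ => ℕ → List (List Ed)) (fun _ => [[]])
    (fun _ ih s => foldL (fun e acc => Bool.rec acc
      (foldL (fun w acc => Bool.rec acc ((e :: w) :: acc) (okW gd e w)) acc (ih e.t))
      (Nat.beq e.s s)) [] E) n

theorem win_mem {E gd e} (h : IsPath E e) (hg : ∀ x, gd (e x) (e (x + 1)) (e (x + 1 + 1)) = true)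
    (n : ℕ) (x : ℤ) : win e x n ∈ pth E gd n (e x).s := by
  induction n generalizing x with
  | zero => simp [win, pth]
  | succ n ih =>
    have m1 : ∀ (v : List Ed) (a : Ed) (w : List Ed) (acc : List (List Ed)), v ∈ acc →
        v ∈ (Bool.rec acc ((a :: w) :: acc) (okW gd a w) : List (List Ed)) := by
      intro v a w acc hv
      cases okW gd a w
      · exact hv
      · exact List.mem_cons_of_mem _ hv
    refine mem_foldL _ _ _ _ (fun a acc hx => ?_) (Or.inr ⟨e x, h.mem x, fun acc => ?_⟩)
    · cases Nat.beq a.s (e x).s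
      · exact hx
      · exact foldL_mono _ _ _ _ (fun _ _ => m1 _ _ _ _) hx
    · have : Nat.beq (e x).s (e x).s = true := by simp
      rw [this]
      refine mem_foldL _ _ _ _ (fun _ _ => m1 _ _ _ _) (Or.inr ⟨win e (x + 1) n, ?_, fun acc => ?_⟩)
      · rw [h.lk]; exact ih _
      · have : okW gd (e x) (win e (x + 1) n) = true := by
          match n with
          | 0 => rfl
          | 1 => rfl
          | n + 2 => exact hg x
        rw [this]
        exact List.mem_cons_self

def nthE (l : List Ed) : ℕ → Ed :=
  List.rec (motive := fun _ => ℕ → Ed) (fun _ => ⟨0, 0, 0, 0⟩) (fun a _ ih n =>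
    Nat.rec (motive := fun _ => Ed) a (fun m _ => ih m) n) l

theorem nth_win (e : ℤ → Ed) (x : ℤ) (n j : ℕ) (h : j < n) : nthE (win e x n) j = e (x + j) := by
  induction n generalizing x j with
  | zero => omega
  | succ n ih =>
    cases j with
    | zero => simp; rfl
    | succ j =>
      have : nthE (win e x (n + 1)) (j + 1) = nthE (win e (x + 1) n) j := rfl
      rw [this, ih _ _ (by omega)]
      congr 1; push_cast; ring

def drp (l : List Ed) (n : ℕ) : List Ed :=
  Nat.rec (motive := fun _ => List Ed → List Ed) (fun l => l)
    (fun _ ih l => ih (List.rec (motive := fun _ => List Ed) [] (fun _ t _ => t) l)) n l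

theorem drp_win (e : ℤ → Ed) (x : ℤ) (n j : ℕ) : drp (win e x (n + j)) j = win e (x + j) n := by
  induction j generalizing x with
  | zero => simp [drp]
  | succ j ih =>
    have : drp (win e x (n + (j + 1))) (j + 1) = drp (win e (x + 1) (n + j)) j := rfl
    rw [this, ih]; congr 1; push_cast; ring

/-- Walk along a list. -/
def walk (n : ℕ) : ℕ → List Ed → (ℕ → List Ed → Bool) → Bool :=
  Nat.rec (motive := fun _ => ℕ → List Ed → (ℕ → List Ed → Bool) → Bool) (fun _ _ _ => true)
    (fun _ ih j l f => Bool.rec false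
      (ih (j + 1) (List.rec (motive := fun _ => List Ed) [] (fun _ t _ => t) l) f) (f j l)) n

theorem walk_win {e : ℤ → Ed} {f : ℕ → List Ed → Bool} (n : ℕ) : ∀ (j m : ℕ) (x : ℤ),
    walk n j (win e x (n + m)) f = true → ∀ i < n, f (j + i) (win e (x + i) (n + m - i)) = true := by
  induction n with
  | zero => intro _ _ _ _ i hi; omega
  | succ n ih =>
    intro j m x h i hi
    have e1 : walk (n + 1) j (win e x (n + 1 + m)) f = Bool.rec false
      (walk n (j + 1) (List.rec (motive := fun _ => List Ed) [] (fun _ t _ => t)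
        (win e x (n + 1 + m))) f) (f j (win e x (n + 1 + m))) := rfl
    rw [e1] at h
    rw [show n + 1 + m = (n + m) + 1 by ring] at *
    cases hf : f j (win e x (n + m + 1))
    · rw [hf] at h; cases h
    · rw [hf] at h
      have h := ih (j + 1) m (x + 1) h
      cases i with
      | zero => simpa using hf
      | succ i =>
        have := h i (by omega)
        rw [show j + 1 + i = j + (i + 1) by ring, show x + 1 + (i : ℤ) = x + ((i + 1 : ℕ) : ℤ) by push_cast; ring,
          show n + m - i = n + m + 1 - (i + 1) by omega] at this
        exact this

/-- Patterns of marks on five consecutive symbols; `m` is the marking symbol. -/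
def pt2 (ty : Bool) (a b c d e : ℕ) : Bool :=
  cond ty (Nat.beq a 0 && (Nat.beq b 1 && (Nat.beq c 1 && Nat.beq d 0)))
    (Nat.beq b 1 && (Nat.beq c 0 && (Nat.beq d 0 && Nat.beq e 1)))
def pt3 (ty : Bool) (a b c d e : ℕ) : Bool :=
  cond ty (Nat.beq a 0 && (Nat.beq b 1 && (Nat.beq c 1 && (Nat.beq d 1 && Nat.beq e 0))))
    (Nat.beq a 1 && (Nat.beq b 0 && (Nat.beq c 0 && (Nat.beq d 0 && Nat.beq e 1))))

def at5 (g : Ed → ℕ) (F : ℕ → ℕ → ℕ → ℕ → ℕ → Bool) (l : List Ed) : Bool :=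
  F (g (nthE l 0)) (g (nthE l 1)) (g (nthE l 2)) (g (nthE l 3)) (g (nthE l 4))

def Pat (F : ℕ → ℕ → ℕ → ℕ → ℕ → Bool) (b : ℤ → ℕ) (z : ℤ) : Prop :=
  F (b z) (b (z + 1)) (b (z + 2)) (b (z + 3)) (b (z + 4)) = true

theorem at5_win (g F) (e : ℤ → Ed) (z : ℤ) (n : ℕ) (h : 5 ≤ n) :
    at5 g F (win e z n) = true ↔ Pat F (fun x => g (e x)) z := by
  unfold at5 Pat
  rw [nth_win _ _ _ _ (by omega), nth_win _ _ _ _ (by omega), nth_win _ _ _ _ (by omega),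
    nth_win _ _ _ _ (by omega), nth_win _ _ _ _ (by omega)]
  simp

def lenN (p q : ℕ) (k : K) : ℕ := K.rec p p q q (p + p) k

theorem lenN_eq (p q : ℕ) (k : K) : (lenN p q k : ℤ) = len p q k := by
  cases k <;> simp [lenN, two_mul]

def beqB (a b : Bool) : Bool := Bool.rec (Bool.rec true false b) b a
theorem beqB_iff {a b : Bool} : beqB a b = true ↔ a = b := by cases a <;> cases b <;> simp [beqB]

/-- expected marks -/
def xi2 (p q : ℕ) (k : K) (j : ℕ) : Bool :=
  K.rec (Nat.beq j 0) false false false (Nat.beq j (Nat.sub q p)) k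
def xi3 (k : K) (j : ℕ) : Bool := K.rec false false (Nat.beq j 0) false false k
def xo2 (p q : ℕ) (k : K) (j : ℕ) : Bool :=
  K.rec false (Nat.beq j 0) false false (Nat.beq j (Nat.sub (p + p) q)) k
def xo3 (p q : ℕ) (k : K) (j : ℕ) : Bool := K.rec false false false (Nat.beq j (Nat.sub q p)) false k

structure Cfg where
  E : List Ed
  gd : Ed → Ed → Ed → Bool
  hub : ℕ
  p : ℕ
  q : ℕ
  ci : ℕ
  co : ℕ
  ty : Bool

def Cfg.L (C : Cfg) : ℕ := C.p + C.p + C.ci + C.co + 4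

def Cfg.sym (C : Cfg) : ℕ := cond C.ty 1 0

/-- kind of the block starting at index `1` of the window -/
def Cfg.kd (C : Cfg) (w : List Ed) : Option K :=
  cond (Nat.beq (nthE w (C.p + 1)).s C.hub)
    (some (cond (anyL (fun j => Nat.beq (nthE w (j + 1)).i C.sym) (List.range C.p)) k1 k2))
    (cond (Nat.beq (nthE w (C.q + 1)).s C.hub)
      (some (cond (anyL (fun j => Nat.beq (nthE w (j + 1)).i C.sym) (List.range C.q)) k3 k4))
      (some k5))

def Cfg.chkK (C : Cfg) (w : List Ed) (k : K) : Bool :=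
  Nat.beq (nthE w (lenN C.p C.q k + 1)).s C.hub &&
  (walk (Nat.sub (lenN C.p C.q k) 1) 0 (drp w 2) (fun _ l => not (Nat.beq (nthE l 0).s C.hub)) &&
  (walk (lenN C.p C.q k) 0 (drp w C.ci) (fun j l =>
    beqB (at5 Ed.i (pt2 C.ty) l) (xi2 C.p C.q k j) && beqB (at5 Ed.i (pt3 C.ty) l) (xi3 k j)) &&
  walk (lenN C.p C.q k) 0 (drp w C.co) (fun j l =>
    beqB (at5 Ed.o (pt2 (not C.ty)) l) (xo2 C.p C.q k j) &&
    beqB (at5 Ed.o (pt3 (not C.ty)) l) (xo3 C.p C.q k j))))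

def Cfg.chk (C : Cfg) (w : List Ed) : Bool :=
  Option.rec false (fun k => C.chkK w k) (C.kd w)

def allL {α : Type} (p : α → Bool) (l : List α) : Bool :=
  List.rec (motive := fun _ => Bool) true (fun a _ ih => Bool.rec false ih (p a)) l

theorem allL_iff {α : Type} (p : α → Bool) (l : List α) : allL p l = true ↔ ∀ a ∈ l, p a = true := by
  induction l with
  | nil => simp [allL]
  | cons a l ih =>
    have : allL p (a :: l) = Bool.rec false (allL p l) (p a) := rfl
    rw [this]
    cases h : p a <;> simp [h, ih]

def Cfg.all (C : Cfg) : Bool :=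
  allL (fun e => Bool.rec true (allL (fun w => Bool.rec true (C.chk (e :: w)) (okW C.gd e w))
    (pth C.E C.gd (Nat.sub C.L 1) C.hub)) (Nat.beq e.t C.hub)) C.E

def Cfg.cov (C : Cfg) : Bool :=
  allL (fun e => allL (fun w => anyL (fun f => Nat.beq f.s C.hub) w) (pth C.E C.gd (C.p + C.p) e.s)) C.E

def gdT : Ed → Ed → Ed → Bool := fun _ _ _ => true
def gdB : Ed → Ed → Ed → Bool := fun e f g =>
  Bool.rec true false (Nat.beq e.i 0 && (Nat.beq f.i 1 && Nat.beq g.i 0)) &&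
  Bool.rec true false (Nat.beq e.o 1 && (Nat.beq f.o 0 && Nat.beq g.o 1))

def C0 : Cfg := ⟨LB, gdB, 12, 5, 8, 3, 1, true⟩
def C1 : Cfg := ⟨AA, gdT, 81, 8, 13, 3, 0, false⟩
def C2 : Cfg := ⟨BAB, gdT, 4877, 13, 21, 11, 6, true⟩
theorem C0_cov : C0.cov = true := by decide +kernel
theorem C1_cov : C1.cov = true := by decide +kernel
theorem C2_cov : C2.cov = true := by decide +kernel
theorem C0_all : C0.all = true := by decide +kernel
theorem C1_all : C1.all = true := by decide +kernel
theorem C2_all : C2.all = true := by decide +kernel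
end
end TDProof

namespace TDProof
open K
set_option linter.all false
noncomputable section

def Cfg.H (C : Cfg) (e : ℤ → Ed) (y : ℤ) (k : K) : Prop :=
  (e y).s = C.hub ∧ C.kd (win e (y - 1) C.L) = some k

structure Cfg.Ok (C : Cfg) : Prop where
  par : Par C.p C.q
  cov : C.cov = true
  all : C.all = true

variable {C : Cfg} {e : ℤ → Ed}

theorem Cfg.Ok.hubK (c : C.Ok) (h : IsPath C.E e)
    (hg : ∀ x, C.gd (e x) (e (x + 1)) (e (x + 1 + 1)) = true) {y : ℤ} (hy : (e y).s = C.hub) :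
    ∃ k, C.kd (win e (y - 1) C.L) = some k ∧ C.chkK (win e (y - 1) C.L) k = true := by
  have hL : C.L = Nat.sub C.L 1 + 1 := rfl
  have a := c.all
  unfold Cfg.all at a
  rw [allL_iff] at a
  have a := a (e (y - 1)) (h.mem _)
  have t : Nat.beq (e (y - 1)).t C.hub = true := by
    have := h.lk (y - 1); simp only [sub_add_cancel] at this; simp [this, hy]
  rw [t] at a
  have a := (allL_iff _ _).1 a (win e y (Nat.sub C.L 1)) (hy ▸ win_mem h hg _ _)
  have o : okW C.gd (e (y - 1)) (win e y (Nat.sub C.L 1)) = true := by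
    have hh := hg (y - 1)
    rw [sub_add_cancel] at hh
    rcases Nat.sub C.L 1 with _ | _ | n
    · rfl
    · rfl
    · exact hh
  rw [o] at a
  have w : win e (y - 1) C.L = e (y - 1) :: win e y (Nat.sub C.L 1) := by
    conv_lhs => rw [hL]
    simp only [win, sub_add_cancel]
  rw [w]
  have a : C.chk (e (y - 1) :: win e y (Nat.sub C.L 1)) = true := a
  unfold Cfg.chk at a
  cases hk : C.kd (e (y - 1) :: win e y (Nat.sub C.L 1)) with
  | none => rw [hk] at a; cases a
  | some k => rw [hk] at a; exact ⟨k, rfl, a⟩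

theorem Cfg.Ok.facts (c : C.Ok) (h : IsPath C.E e)
    (hg : ∀ x, C.gd (e x) (e (x + 1)) (e (x + 1 + 1)) = true) {y : ℤ} {k} (hy : C.H e y k) :
    (e (y + lenN C.p C.q k)).s = C.hub ∧
    (∀ i : ℕ, i < lenN C.p C.q k - 1 → (e (y + 1 + i)).s ≠ C.hub) ∧
    (∀ i : ℕ, i < lenN C.p C.q k →
      (Pat (pt2 C.ty) (fun x => (e x).i) (y - 1 + C.ci + i) ↔ xi2 C.p C.q k i = true) ∧
      (Pat (pt3 C.ty) (fun x => (e x).i) (y - 1 + C.ci + i) ↔ xi3 k i = true)) ∧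
    (∀ i : ℕ, i < lenN C.p C.q k →
      (Pat (pt2 (not C.ty)) (fun x => (e x).o) (y - 1 + C.co + i) ↔ xo2 C.p C.q k i = true) ∧
      (Pat (pt3 (not C.ty)) (fun x => (e x).o) (y - 1 + C.co + i) ↔ xo3 C.p C.q k i = true)) := by
  obtain ⟨hy, hk⟩ := hy
  obtain ⟨k', hk', a⟩ := c.hubK h hg hy
  obtain rfl : k' = k := by rw [hk] at hk'; exact (Option.some.inj hk').symm
  unfold Cfg.chkK at a
  simp only [Bool.and_eq_true] at a
  obtain ⟨a1, a2, a3, a4⟩ := a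
  have l1 : lenN C.p C.q k' ≤ C.p + C.p := by
    have := len_le c.par k'; rw [← lenN_eq] at this; omega
  have l2 : 5 ≤ lenN C.p C.q k' := by
    have := len_pos c.par k'; rw [← lenN_eq] at this; have := c.par.c; omega
  set l := lenN C.p C.q k' with hl
  have hL : C.L = C.p + C.p + C.ci + C.co + 4 := rfl
  refine ⟨?_, ?_, ?_, ?_⟩
  · rw [nth_win _ _ _ _ (by omega)] at a1
    have := Nat.eq_of_beq_eq_true a1
    rw [← this]; congr 2; push_cast; ring
  · intro i hi hh
    obtain ⟨m, hm⟩ : ∃ m, C.L = (l - 1 + m) + 2 := ⟨C.L - 2 - (l - 1), by omega⟩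
    rw [hm, drp_win] at a2
    have := walk_win (l - 1) _ _ _ a2 i hi
    rw [nth_win _ _ _ _ (by omega)] at this
    have e1 : y - 1 + (2 : ℕ) + (i : ℤ) + (0 : ℕ) = y + 1 + i := by push_cast; ring
    rw [e1, hh] at this
    simp at this
  · intro i hi
    obtain ⟨m, hm⟩ : ∃ m, C.L = (l + m) + C.ci := ⟨C.L - C.ci - l, by omega⟩
    rw [hm, drp_win] at a3
    have := walk_win l _ _ _ a3 i hi
    simp only [Bool.and_eq_true, beqB_iff, zero_add] at this
    rw [← at5_win Ed.i (pt2 C.ty) e _ (l + m - i) (by omega),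
      ← at5_win Ed.i (pt3 C.ty) e _ (l + m - i) (by omega), this.1, this.2]
    exact ⟨Iff.rfl, Iff.rfl⟩
  · intro i hi
    obtain ⟨m, hm⟩ : ∃ m, C.L = (l + m) + C.co := ⟨C.L - C.co - l, by omega⟩
    rw [hm, drp_win] at a4
    have := walk_win l _ _ _ a4 i hi
    simp only [Bool.and_eq_true, beqB_iff, zero_add] at this
    rw [← at5_win Ed.o (pt2 (not C.ty)) e _ (l + m - i) (by omega),
      ← at5_win Ed.o (pt3 (not C.ty)) e _ (l + m - i) (by omega), this.1, this.2]
    exact ⟨Iff.rfl, Iff.rfl⟩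

theorem Cfg.Ok.run (c : C.Ok) (h : IsPath C.E e)
    (hg : ∀ x, C.gd (e x) (e (x + 1)) (e (x + 1 + 1)) = true) : Run C.p C.q (C.H e) := by
  have hub : ∀ y, (e y).s = C.hub → ∃ k, C.H e y k := fun y hy => by
    obtain ⟨k, hk, _⟩ := c.hubK h hg hy
    exact ⟨k, hy, hk⟩
  apply Run.mk' c.par
  · intro z
    have a := c.cov
    unfold Cfg.cov at a
    rw [allL_iff] at a
    set x := z - (C.p + C.p) with hx
    have a := (allL_iff _ _).1 (a (e x) (h.mem _)) _ (win_mem h hg (C.p + C.p) x)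
    rw [anyL_iff] at a
    obtain ⟨f, hf, hf'⟩ := a
    have : ∀ (n : ℕ) (x : ℤ), f ∈ win e x n → ∃ i : ℕ, i < n ∧ f = e (x + i) := by
      intro n
      induction n with
      | zero => intro x hx; simp [win] at hx
      | succ n ih =>
        intro x hx
        rcases List.mem_cons.1 hx with rfl | hx
        · exact ⟨0, by omega, by simp⟩
        · obtain ⟨i, hi, h⟩ := ih _ hx
          refine ⟨i + 1, by omega, ?_⟩
          rw [h]; congr 1; push_cast; ring
    obtain ⟨i, hi, rfl⟩ := this _ _ hf
    obtain ⟨k, hk⟩ := hub _ (Nat.eq_of_beq_eq_true hf')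
    exact ⟨_, k, by omega, hk⟩
  · intro x k hx
    rw [← lenN_eq]
    exact hub _ (c.facts h hg hx).1
  · intro x k y k' hx hy h1 h2
    rw [← lenN_eq] at h2
    have f := (c.facts h hg hx).2.1
    have : x = y := by
      by_contra hne
      have := f (y - x - 1).toNat (by omega)
      rw [show x + 1 + ((y - x - 1).toNat : ℤ) = y by omega] at this
      exact this hy.1
    subst this
    refine ⟨rfl, ?_⟩
    have := hx.2.symm.trans hy.2
    exact Option.some.inj this

/-- evaluate marks inside a block -/
theorem Run.markAt {p q : ℤ} {H} (hr : Run p q H) (hp : Par p q) {y k} (h : H y k) {j : ℤ}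
    (h0 : 0 ≤ j) (h1 : j < len p q k) (k' : K) (d : ℤ) (hd : 0 ≤ d) (hd' : d < len p q k') :
    H (y + j - d) k' ↔ k = k' ∧ j = d := by
  constructor
  · intro h'
    have := hr.sp hp h h'
    rcases this with ⟨a, b⟩ | a | a
    · exact ⟨b, by omega⟩
    · omega
    · omega
  · rintro ⟨rfl, rfl⟩
    simpa using h

theorem Cfg.Ok.marks (c : C.Ok) (h : IsPath C.E e)
    (hg : ∀ x, C.gd (e x) (e (x + 1)) (e (x + 1 + 1)) = true) (u : ℤ) :
    (Pat (pt2 C.ty) (fun x => (e x).i) (u + (C.ci - 1)) ↔ in2 C.p C.q (C.H e) u) ∧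
    (Pat (pt3 C.ty) (fun x => (e x).i) (u + (C.ci - 1)) ↔ in3 (C.H e) u) ∧
    (Pat (pt2 (not C.ty)) (fun x => (e x).o) (u + (C.co - 1)) ↔ out2 C.p C.q (C.H e) u) ∧
    (Pat (pt3 (not C.ty)) (fun x => (e x).o) (u + (C.co - 1)) ↔ out3 C.p C.q (C.H e) u) := by
  have hr := c.run h hg
  obtain ⟨y, k, hk, h1, h2⟩ := hr.cover c.par u
  obtain ⟨_, _, f3, f4⟩ := c.facts h hg hk
  rw [← lenN_eq] at h2
  obtain ⟨i, rfl⟩ : ∃ i : ℕ, u = y + i := ⟨(u - y).toNat, by omega⟩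
  have hi : i < lenN C.p C.q k := by omega
  have f3 := f3 i hi
  have f4 := f4 i hi
  rw [show y - 1 + (C.ci : ℤ) + i = y + i + (C.ci - 1) by ring] at f3
  rw [show y - 1 + (C.co : ℤ) + i = y + i + (C.co - 1) by ring] at f4
  rw [f3.1, f3.2, f4.1, f4.2]
  have hi' : (i : ℤ) < len C.p C.q k := by rw [← lenN_eq]; omega
  have m := fun k' d hd hd' => hr.markAt c.par hk (Int.natCast_nonneg i) hi' k' d hd hd'
  obtain ⟨pa, pb, pc⟩ := c.par
  have m0 := fun k' => m k' 0 le_rfl (by have := len_pos c.par k'; omega)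
  simp only [sub_zero] at m0
  unfold in2 in3 out2 out3
  rw [m0, m0, m0, m k5 _ (by omega) (by simp; omega), m k5 _ (by omega) (by simp; omega),
    m k4 _ (by omega) (by simp; omega)]
  cases k <;> simp [xi2, xi3, xo2, xo3] <;> omega

theorem C0_ok : C0.Ok := ⟨by constructor <;> simp [C0], C0_cov, C0_all⟩
theorem C1_ok : C1.Ok := ⟨by constructor <;> simp [C1], C1_cov, C1_all⟩
theorem C2_ok : C2.Ok := ⟨by constructor <;> simp [C2], C2_cov, C2_all⟩

/-- The in-words of `AA` avoid `101`, the out-words avoid `010`. -/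
theorem AA_avoid : allL (fun e => allL (fun w => gdB ⟨0, 0, (nthE w 0).o, (nthE w 0).i⟩
    ⟨0, 0, (nthE w 1).o, (nthE w 1).i⟩ ⟨0, 0, (nthE w 2).o, (nthE w 2).i⟩)
    (pth AA gdT 3 e.s)) AA = true := by decide +kernel

theorem avoid (h : IsPath AA e) (x : ℤ) :
    gdB ⟨0, 0, (e x).o, (e x).i⟩ ⟨0, 0, (e (x + 1)).o, (e (x + 1)).i⟩
      ⟨0, 0, (e (x + 1 + 1)).o, (e (x + 1 + 1)).i⟩ = true := by
  have := (allL_iff _ _).1 ((allL_iff _ _).1 AA_avoid (e x) (h.mem x)) _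
    (win_mem (gd := gdT) h (fun _ => rfl) 3 x)
  exact this
end
end TDProof

namespace TDProof
open K
set_option linter.all false
noncomputable section

theorem Cfg.ms {C C' : Cfg} {e e' : ℤ → Ed} (c : C.Ok) (c' : C'.Ok) (h : IsPath C.E e)
    (hg : ∀ x, C.gd (e x) (e (x + 1)) (e (x + 1 + 1)) = true) (h' : IsPath C'.E e')
    (hg' : ∀ x, C'.gd (e' x) (e' (x + 1)) (e' (x + 1 + 1)) = true)
    (ho : ∀ x, (e x).o = (e' x).i) (ht : C'.ty = not C.ty) :
    ∃ s : ℤ, ∀ x, (out2 C.p C.q (C.H e) x ↔ in2 C'.p C'.q (C'.H e') (x - s)) ∧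
      (out3 C.p C.q (C.H e) x ↔ in3 (C'.H e') (x - s)) := by
  refine ⟨C'.ci - C.co, fun x => ?_⟩
  obtain ⟨-, -, a, b⟩ := c.marks h hg x
  obtain ⟨a', b', -, -⟩ := c'.marks h' hg' (x - (C'.ci - C.co))
  rw [← a, ← b, ← a', ← b', show x - ((C'.ci : ℤ) - C.co) + (C'.ci - 1) = x + (C.co - 1) by ring, ht,
    show (fun x => (e x).o) = (fun x => (e' x).i) from funext ho]
  exact ⟨Iff.rfl, Iff.rfl⟩

/-- A stack of rows. -/
structure Stk (A : ℤ → Prop) (E : ℤ → ℤ → Ed) : Prop where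
  pa : ∀ y, A y → IsPath LA (E y)
  pb : ∀ y, ¬ A y → IsPath LB (E y)
  ho : ∀ y x, (E y x).o = (E (y + 1) x).i

variable {A : ℤ → Prop} {E : ℤ → ℤ → Ed}

theorem gdB_and {a b c a' b' c' : Ed} {e f g : Ed}
    (h : gdB ⟨0,0,a.o,a.i⟩ ⟨0,0,b.o,b.i⟩ ⟨0,0,c.o,c.i⟩ = true)
    (h' : gdB ⟨0,0,a'.o,a'.i⟩ ⟨0,0,b'.o,b'.i⟩ ⟨0,0,c'.o,c'.i⟩ = true)
    (e1 : a.o = e.i) (e2 : b.o = f.i) (e3 : c.o = g.i)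
    (f1 : e.o = a'.i) (f2 : f.o = b'.i) (f3 : g.o = c'.i) : gdB e f g = true := by
  unfold gdB at *
  simp only [Bool.and_eq_true] at *
  rw [← e1, ← e2, ← e3, f1, f2, f3]
  exact ⟨h.1, h'.2⟩

def sV0 (A : ℤ → Prop) (y : ℤ) : Prop := ¬ A y ∧ A (y + 1) ∧ A (y + 2) ∧ A (y - 1) ∧ A (y - 2)
def sV1 (A : ℤ → Prop) (y : ℤ) : Prop := A y ∧ A (y + 1)
def sV2 (A : ℤ → Prop) (y : ℤ) : Prop := ¬ A y ∧ A (y + 1) ∧ ¬ A (y + 2)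

open Classical in
def sH (A : ℤ → Prop) (E : ℤ → ℤ → Ed) (y : ℤ) : ℤ → K → Prop :=
  if sV0 A y then C0.H (E y) else if sV1 A y then C1.H (fun x => mulE (E y x) (E (y + 1) x))
  else C2.H (fun x => mulE (mulE (E y x) (E (y + 1) x)) (E (y + 1 + 1) x))

theorem Stk.bb (h : Stk A E) (y : ℤ) (h0 : ¬ A y) : A (y + 1) := by
  by_contra h1
  exact no_bb (h.pb _ h0) (h.pb _ h1) (h.ho y)

theorem Stk.aaa (h : Stk A E) (y : ℤ) (h0 : A y) (h1 : A (y + 1)) : ¬ A (y + 1 + 1) := fun h2 =>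
  no_aaa (h.pa _ h0) (h.pa _ h1) (h.pa _ h2) (h.ho y) (h.ho _)

theorem Stk.babab (h : Stk A E) (y : ℤ) (h0 : ¬ A y) (h2 : ¬ A (y + 1 + 1)) : A (y + 1 + 1 + 1 + 1) := by
  by_contra h4
  exact no_babab (h.pb _ h0) (h.pa _ (h.bb _ h0)) (h.pb _ h2) (h.pa _ (h.bb _ h2)) (h.pb _ h4)
    (h.ho _) (h.ho _) (h.ho _) (h.ho _)

theorem Stk.p1 (h : Stk A E) {y} (v : sV1 A y) : IsPath C1.E (fun x => mulE (E y x) (E (y + 1) x)) :=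
  pathAA (h.pa _ v.1) (h.pa _ v.2) (h.ho y)

theorem Stk.p2 (h : Stk A E) {y} (v : sV2 A y) :
    IsPath C2.E (fun x => mulE (mulE (E y x) (E (y + 1) x)) (E (y + 1 + 1) x)) :=
  pathBAB (h.pb _ v.1) (h.pa _ v.2.1) (h.pb _ (by have := v.2.2; rwa [add_assoc])) (h.ho y) (h.ho _)

theorem Stk.p0 (h : Stk A E) {y} (v : sV0 A y) : IsPath C0.E (E y) := h.pb _ v.1

theorem Stk.g0 (h : Stk A E) {y} (v : sV0 A y) (x : ℤ) :
    C0.gd (E y x) (E y (x + 1)) (E y (x + 1 + 1)) = true := by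
  have v1 : sV1 A (y + 1) := ⟨v.2.1, by rw [add_assoc]; exact v.2.2.1⟩
  have v2 : sV1 A (y - 2) := ⟨v.2.2.2.2, by convert v.2.2.2.1 using 1; ring⟩
  have e : ∀ x, (E (y - 2 + 1) x).o = (E y x).i := fun x => by
    rw [h.ho, show y - 2 + 1 + 1 = y by ring]
  exact gdB_and (avoid (h.p1 v2) x) (avoid (h.p1 v1) x) (e _) (e _) (e _) (h.ho _ _) (h.ho _ _) (h.ho _ _)

theorem Stk.lev (h : Stk A E) : Lev 0 (sV0 A) (sV1 A) (sV2 A) := by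
  have bb : ∀ y z, z = y + 1 → ¬ A y → A z := fun y z e h0 => e ▸ h.bb _ h0
  have aaa : ∀ y z w, z = y + 1 → w = y + 2 → A y → A z → ¬ A w := fun y z w e e' h0 h1 => by
    subst e; subst e'
    have := h.aaa _ h0 h1
    rwa [add_assoc] at this
  have bab : ∀ y z w, z = y + 2 → w = y + 4 → ¬ A y → ¬ A z → A w := fun y z w e e' h0 h1 => by
    subst e; subst e'
    have := h.babab y h0 (by convert h1 using 2; ring)
    convert this using 1; ring
  have m01 : ∀ y, sV0 A y → sV1 A (y + 1) := fun y v => ⟨v.2.1, by rw [add_assoc]; exact v.2.2.1⟩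
  have m21 : ∀ y, sV2 A y → sV1 A (y + 3) := fun y v => by
    have a := bb (y + 2) (y + 3) (by ring) v.2.2
    have b := bab y (y + 2) (y + 4) rfl rfl v.1 v.2.2
    exact ⟨a, by rw [add_assoc]; exact b⟩
  have d1 : ∀ y, sV1 A y → ¬ sV0 A y := fun y v w => w.1 v.1
  have d2 : ∀ y, sV1 A y → ¬ sV2 A y := fun y v w => w.1 v.1
  have d02 : ∀ y, sV0 A y → ¬ sV2 A y := fun y v w => w.2.2 v.2.2.1
  have s1 : ∀ y, sV1 A y → ¬ sV0 A (y + 1) ∧ ¬ sV1 A (y + 1) ∧ ¬ sV2 A (y + 1) := fun y v =>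
    ⟨fun w => w.1 v.2, fun w => h.aaa _ v.1 v.2 w.2, fun w => w.1 v.2⟩
  have s2 : ∀ y, sV2 A y → (¬ sV0 A (y + 1) ∧ ¬ sV1 A (y + 1) ∧ ¬ sV2 A (y + 1)) ∧
    (¬ sV0 A (y + 2) ∧ ¬ sV1 A (y + 2) ∧ ¬ sV2 A (y + 2)) := fun y v => by
    refine ⟨⟨fun w => w.1 v.2.1, fun w => v.2.2 ?_, fun w => w.1 v.2.1⟩, ⟨fun w => v.1 ?_, fun w => v.2.2 w.1,
      fun w => w.2.2 ?_⟩⟩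
    · have := w.2; rwa [add_assoc] at this
    · have := w.2.2.2.2; rwa [add_sub_cancel_right] at this
    · exact bab y _ _ rfl (by ring) v.1 v.2.2
  have n1 : ∀ y, sV1 A y → sV0 A (y + 2) ∨ sV2 A (y + 2) := fun y v => by
    have a : ¬ A (y + 2) := aaa _ _ _ rfl rfl v.1 v.2
    have b := bb (y + 2) (y + 2 + 1) rfl a
    by_cases c : A (y + 2 + 2)
    · left
      refine ⟨a, b, c, ?_, ?_⟩
      · convert v.2 using 1; ring
      · convert v.1 using 1; ring
    · exact Or.inr ⟨a, b, c⟩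
  refine ⟨?_, m01, n1, m21, ?_, ?_, ?_, fun y v w => d1 _ w v, d02, d2, sH A E, ?_, ?_, ?_⟩
  · by_cases a0 : A 0
    · by_cases a1 : A 1
      · exact ⟨0, Or.inr (Or.inl ⟨a0, a1⟩)⟩
      · have a2 := bb 1 2 (by norm_num) a1
        by_cases a3 : A 3
        · exact ⟨2, Or.inr (Or.inl ⟨a2, a3⟩)⟩
        · exact ⟨1, Or.inr (Or.inr ⟨a1, a2, a3⟩)⟩
    · have a2 := bb 0 1 (by norm_num) a0
      by_cases a3 : A 2
      · exact ⟨1, Or.inr (Or.inl ⟨a2, a3⟩)⟩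
      · exact ⟨0, Or.inr (Or.inr ⟨a0, a2, a3⟩)⟩
  · intro y z v h1 h2
    simp only [ht] at h2; omega
  · intro y z v h1 h2
    simp only [ht] at h2
    obtain rfl : z = y + 1 := by omega
    exact s1 y v
  · intro y z v h1 h2
    simp only [ht] at h2
    obtain rfl | rfl : z = y + 1 ∨ z = y + 2 := by omega
    · exact (s2 y v).1
    · exact (s2 y v).2
  · intro y v
    have e0 : sH A E y = C0.H (E y) := if_pos v
    have v1 := m01 y v
    have e1 : sH A E (y + ht 0) = C1.H (fun x => mulE (E (y + 1) x) (E (y + 1 + 1) x)) := by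
      simp only [ht]; unfold sH; rw [if_neg (d1 _ v1), if_pos v1]
    rw [e0, e1]
    exact ⟨C0_ok.run (h.p0 v) (h.g0 v), Cfg.ms C0_ok C1_ok (h.p0 v) (h.g0 v) (h.p1 v1) (fun _ => rfl)
      (fun x => h.ho _ _) rfl⟩
  · intro y v
    have e0 : sH A E y = C2.H (fun x => mulE (mulE (E y x) (E (y + 1) x)) (E (y + 1 + 1) x)) := by
      unfold sH; rw [if_neg (fun w => d02 _ w v), if_neg (fun w => d2 _ w v)]
    have v1 := m21 y v
    have e1 : sH A E (y + ht (0 + 2)) = C1.H (fun x => mulE (E (y + 3) x) (E (y + 3 + 1) x)) := by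
      simp only [ht]; unfold sH; rw [if_neg (d1 _ v1), if_pos v1]
    rw [e0, e1]
    exact ⟨C2_ok.run (h.p2 v) (fun _ => rfl), Cfg.ms C2_ok C1_ok (h.p2 v) (fun _ => rfl) (h.p1 v1) (fun _ => rfl)
      (fun x => by show (E (y + 1 + 1) x).o = _; rw [h.ho, show y + 1 + 1 + 1 = y + 3 by ring]; rfl) rfl⟩
  · intro y v
    have e0 : sH A E y = C1.H (fun x => mulE (E y x) (E (y + 1) x)) := by
      unfold sH; rw [if_neg (d1 _ v), if_pos v]
    have ho : ∀ x, (E (y + 1) x).o = (E (y + 2) x).i := fun x => by rw [h.ho, add_assoc]; rfl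
    rw [e0]
    refine ⟨C1_ok.run (h.p1 v) (fun _ => rfl), fun w => ?_, fun w => ?_⟩
    · have w : sV0 A (y + 2) := w
      have e1 : sH A E (y + ht (0 + 1)) = C0.H (E (y + 2)) := if_pos w
      rw [e1]
      exact Cfg.ms C1_ok C0_ok (h.p1 v) (fun _ => rfl) (h.p0 w) (h.g0 w) ho rfl
    · have w : sV2 A (y + 2) := w
      have e1 : sH A E (y + ht (0 + 1)) = C2.H (fun x => mulE (mulE (E (y + 2) x) (E (y + 2 + 1) x)) (E (y + 2 + 1 + 1) x)) := by
        simp only [ht]; unfold sH; rw [if_neg (fun w' => d02 _ w' w), if_neg (fun w' => d2 _ w' w)]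
      rw [e1]
      exact Cfg.ms C1_ok C2_ok (h.p1 v) (fun _ => rfl) (h.p2 w) (fun _ => rfl) ho rfl

theorem Stk.aper (h : Stk A E) {v : ℤ} (hv : 0 < v) (hA : ∀ y, A (y + v) ↔ A y) : False := by
  have e : ∀ y z, z = y + v → (A z ↔ A y) := fun y z e => e ▸ hA y
  refine Lev.aper hv v.toNat 0 (by omega) h.lev (fun y => ?_) (fun y => ?_) (fun y => ?_)
  · unfold sV0
    rw [e y (y + v) rfl, e (y + 1) (y + v + 1) (by ring), e (y + 2) (y + v + 2) (by ring),
      e (y - 1) (y + v - 1) (by ring), e (y - 2) (y + v - 2) (by ring)]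
  · unfold sV1
    rw [e y (y + v) rfl, e (y + 1) (y + v + 1) (by ring)]
  · unfold sV2
    rw [e y (y + v) rfl, e (y + 1) (y + v + 1) (by ring), e (y + 2) (y + v + 2) (by ring)]
end
end TDProof

namespace TDProof
open K
set_option linter.all false
noncomputable section

def code : HC → ℕ
  | .a => 0 | .b => 1 | .c => 2 | .d => 3 | .e => 4 | .f => 5 | .g => 6 | .h => 7 | .i => 8 | .j => 9
  | .K => 10 | .L => 11 | .M => 12 | .M' => 13 | .N => 14 | .O => 15 | .O' => 16 | .P => 17 | .Q => 18
  | .R => 19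

abbrev WT := WangTile HC (Fin 2)

def edT (t : WT) : Ed := ⟨code t.west, code t.east, t.south.val, t.north.val⟩

theorem edT_a {t : WT} (h : t ∈ Ta) : edT t ∈ LA ∧ code t.west < 10 ∧ code t.east < 10 := by
  simp only [Ta, Set.mem_insert_iff, Set.mem_singleton_iff] at h
  rcases h with rfl | rfl | rfl | rfl | rfl | rfl | rfl | rfl | rfl | rfl | rfl | rfl | rfl | rfl <;>
    decide

theorem edT_b {t : WT} (h : t ∈ Tb) : edT t ∈ LB ∧ ¬ code t.west < 10 ∧ ¬ code t.east < 10 := by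
  simp only [Tb, Set.mem_insert_iff, Set.mem_singleton_iff] at h
  rcases h with rfl | rfl | rfl | rfl | rfl | rfl | rfl | rfl | rfl | rfl | rfl | rfl | rfl | rfl <;>
    decide

theorem TD_fin : TD.Finite := by
  unfold TD Ta Tb
  exact Set.toFinite _

/-- Row `y` is of type `a`. -/
def rowA (f : ℤ × ℤ → WT) (y : ℤ) : Prop := code (f (0, y)).west < 10

theorem rowA_iff {f : ℤ × ℤ → WT} (h : Tiling TD f) (x y : ℤ) : code (f (x, y)).west < 10 ↔ rowA f y := by
  have st : ∀ x, code (f (x, y)).west < 10 ↔ code (f (x + 1, y)).west < 10 := fun x => by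
    rw [← h.2.1 x y trivial trivial]
    rcases h.1 (x, y) trivial with a | b
    · simp [edT_a a]
    · have := edT_b b; tauto
  induction x using Int.induction_on with
  | zero => exact Iff.rfl
  | succ i ih => exact (st i).symm.trans ih
  | pred i ih =>
    have := st (-(i : ℤ) - 1)
    rw [sub_add_cancel] at this
    exact this.trans ih

theorem Tiling.stk {f : ℤ × ℤ → WT} (h : Tiling TD f) : Stk (rowA f) (fun y x => edT (f (x, y))) := by
  have lk : ∀ x y, (edT (f (x, y))).t = (edT (f (x + 1, y))).s := fun x y => by
    show code _ = code _; rw [h.2.1 x y trivial trivial]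
  refine ⟨fun y hy => ⟨fun x => ?_, fun x => lk _ _⟩, fun y hy => ⟨fun x => ?_, fun x => lk _ _⟩, fun y x => ?_⟩
  · rw [← rowA_iff h x y] at hy
    rcases h.1 (x, y) trivial with a | b
    · exact (edT_a a).1
    · exact absurd hy (edT_b b).2.1
  · rw [← rowA_iff h x y] at hy
    rcases h.1 (x, y) trivial with a | b
    · exact absurd (edT_a a).2.1 hy
    · exact (edT_b b).1
  · show (f (x, y)).north.val = (f (x, y + 1)).south.val
    rw [h.2.2 x y trivial trivial]

theorem Stk.fold {A : ℤ → Prop} {E : ℤ → ℤ → Ed} (h : Stk A E) {y1 y2 : ℤ} (hy : y1 < y2) (hE : E y1 = E y2) : False := by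
  have hd : 0 < y2 - y1 := by omega
  have s : Stk (fun y => A (y1 + (y - y1) % (y2 - y1))) (fun y => E (y1 + (y - y1) % (y2 - y1))) := by
    refine ⟨fun y => h.pa _, fun y => h.pb _, fun y x => ?_⟩
    have e := Int.emod_nonneg (y - y1) hd.ne'
    have e' := Int.emod_lt_of_pos (y - y1) hd
    have e1 : (y + 1 - y1) % (y2 - y1) = ((y - y1) % (y2 - y1) + 1) % (y2 - y1) := by
      rw [Int.emod_add_emod]; congr 1; ring
    rw [e1, h.ho]
    by_cases c : (y - y1) % (y2 - y1) + 1 < y2 - y1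
    · rw [Int.emod_eq_of_lt (by omega) c, add_assoc]
    · have c : (y - y1) % (y2 - y1) + 1 = y2 - y1 := by omega
      rw [add_assoc, c, Int.emod_self, add_zero, hE, add_sub_cancel]
  refine s.aper hd (fun y => ?_)
  rw [show y + (y2 - y1) - y1 = (y - y1) + (y2 - y1) by ring, Int.add_emod_right]

theorem no_period (f : ℤ × ℤ → WT) (h : Tiling TD f) : ¬ PeriodicTiling f := by
  rintro ⟨u, v, hne, hp⟩
  have key : ∀ y, rowA f (y + v) ↔ rowA f y := fun y => by
    rw [← rowA_iff h u (y + v), ← rowA_iff h 0 y, ← hp 0 y, zero_add]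
  rcases lt_trichotomy v 0 with hv | hv | hv
  · refine (Tiling.stk h).aper (v := -v) (by omega) (fun y => ?_)
    rw [← key, neg_add_cancel_right]
  · subst hv
    have hu : u ≠ 0 := by rintro rfl; exact hne rfl
    haveI : Finite TD := TD_fin
    let R : ℤ → (Fin u.natAbs → TD) := fun y i => ⟨f (i, y), h.1 _ trivial⟩
    obtain ⟨y1, y2, hy, hR⟩ := Finite.exists_ne_map_eq_of_infinite R
    have per : ∀ x y, f (x, y) = f (x % u, y) := fun x y => by
      have p : Function.Periodic (fun x => f (x, y)) u := fun x => by
        have := hp x y; rwa [add_zero] at this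
      have := p.int_mul (x / u) (x % u)
      refine Eq.trans ?_ this
      show f (x, y) = f (_, y)
      congr 2
      have := Int.emod_add_mul_ediv x u
      push_cast
      linarith
    have rows : ∀ x, f (x, y1) = f (x, y2) := fun x => by
      rw [per x y1, per x y2]
      have a := Int.emod_nonneg x hu
      have b := Int.emod_lt_abs x hu
      rw [Int.abs_eq_natAbs] at b
      have := congrArg Subtype.val (congrFun hR ⟨(x % u).toNat, by omega⟩)
      simp only [R] at this
      rwa [Int.toNat_of_nonneg a] at this
    have hE : (fun x => edT (f (x, y1))) = fun x => edT (f (x, y2)) := funext fun x => by rw [rows]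
    rcases lt_or_gt_of_ne hy with hy | hy
    · exact (Tiling.stk h).fold hy hE
    · exact (Tiling.stk h).fold hy hE.symm
  · exact (Tiling.stk h).aper hv key
end
end TDProof

namespace TDProof
open K
set_option linter.all false
noncomputable section

/-- A bi-infinite row of tiles with given bottom and top words. -/
def Row (b t : ℤ → Fin 2) : Prop := ∃ g : ℤ → WT, ∀ x, g x ∈ TD ∧ (g x).east = (g (x + 1)).west ∧
  (g x).south = b x ∧ (g x).north = t x

/-- A strip of `n` rows. -/
def St : ℕ → (ℤ → Fin 2) → (ℤ → Fin 2) → Prop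
  | 0, b, t => b = t
  | n + 1, b, t => ∃ c, Row b c ∧ St n c t

theorem St.append {n m b c t} (h : St n b c) (h' : St m c t) : St (n + m) b t := by
  induction n generalizing b with
  | zero => have h : b = c := h; subst h; rwa [zero_add]
  | succ n ih =>
    obtain ⟨d, h1, h2⟩ := h
    rw [show n + 1 + m = n + m + 1 by ring]
    exact ⟨d, h1, ih h2⟩

theorem Row.shift {b t} (h : Row b t) (s : ℤ) : Row (fun x => b (x + s)) (fun x => t (x + s)) := by
  obtain ⟨g, h⟩ := h
  refine ⟨fun x => g (x + s), fun x => ?_⟩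
  have := h (x + s)
  rwa [add_right_comm] at this

theorem St.shift {n b t} (h : St n b t) (s : ℤ) : St n (fun x => b (x + s)) (fun x => t (x + s)) := by
  induction n generalizing b with
  | zero => have h : b = t := h; subst h; rfl
  | succ n ih =>
    obtain ⟨d, h1, h2⟩ := h
    exact ⟨_, h1.shift s, ih h2⟩

open Classical in
/-- The word with given marks. -/
def bits (ty : Bool) (m2 m3 : ℤ → Prop) (z : ℤ) : Fin 2 :=
  if ty then (if m2 z ∨ m2 (z - 1) ∨ m3 z ∨ m3 (z - 1) ∨ m3 (z - 2) then 1 else 0)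
  else (if m2 (z + 1) ∨ m2 (z + 2) ∨ m3 (z + 1) ∨ m3 (z + 2) ∨ m3 (z + 3) then 0 else 1)

def tl : ℕ → WT := fun n => [
  (⟨.a, .b, 1, 0⟩ : WT), ⟨.f, .b, 1, 1⟩, ⟨.g, .a, 1, 1⟩, ⟨.e, .f, 1, 1⟩, ⟨.c, .d, 1, 0⟩,
    ⟨.b, .c, 1, 0⟩, ⟨.b, .g, 1, 1⟩, ⟨.d, .e, 1, 1⟩, ⟨.i, .j, 0, 0⟩, ⟨.c, .i, 0, 0⟩,
    ⟨.d, .h, 0, 0⟩, ⟨.j, .a, 0, 0⟩, ⟨.h, .c, 0, 0⟩, ⟨.h, .g, 0, 1⟩,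
   ⟨.P, .R, 1, 1⟩, ⟨.M', .K, 1, 1⟩, ⟨.R, .M, 1, 1⟩, ⟨.R, .M', 1, 1⟩, ⟨.Q, .O', 0, 0⟩,
    ⟨.N, .O, 0, 1⟩, ⟨.P, .Q, 0, 1⟩, ⟨.M, .N, 0, 1⟩, ⟨.R, .L, 0, 0⟩, ⟨.K, .L, 0, 1⟩,
    ⟨.O, .R, 0, 0⟩, ⟨.O, .P, 0, 1⟩, ⟨.L, .M, 0, 1⟩, ⟨.O', .R, 0, 0⟩].getD n ⟨.a, .b, 1, 0⟩

theorem tl_mem (n : ℕ) : tl n ∈ TD := by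
  by_cases h : n < 14
  · left
    interval_cases n <;> (unfold Ta; repeat first | exact Or.inl rfl | exact rfl | apply Or.inr)
  by_cases h' : n < 28
  · right
    have h : 14 ≤ n := by omega
    interval_cases n <;> (unfold Tb; repeat first | exact Or.inl rfl | exact rfl | apply Or.inr)
  · unfold tl
    rw [List.getD_eq_default _ _ (by simp; omega)]
    exact Or.inl (Or.inl rfl)

def wt (w : K → List ℕ) (k : K) (j : ℕ) : WT := tl ((w k).getD j 0)

def chkW (p q : ℕ) (hub : HC) (w : K → List ℕ) : Prop :=
  ∀ k, ((wt w k 0).west = hub) ∧ ((wt w k (lenN p q k - 1)).east = hub) ∧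
    ∀ j < lenN p q k - 1, (wt w k j).east = (wt w k (j + 1)).west

theorem rowOf {p q : ℕ} {hub w} (hp : Par p q) {H} (hr : Run p q H) (hc : chkW p q hub w) {b t}
    (hb : ∀ y k (j : ℕ), H y k → j < lenN p q k → b (y + j) = (wt w k j).south)
    (ht : ∀ y k (j : ℕ), H y k → j < lenN p q k → t (y + j) = (wt w k j).north) : Row b t := by
  have cov : ∀ z, ∃ y k, ∃ j : ℕ, H y k ∧ j < lenN p q k ∧ z = y + j := fun z => by
    obtain ⟨y, k, h, h1, h2⟩ := hr.cover hp z
    rw [← lenN_eq] at h2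
    exact ⟨y, k, (z - y).toNat, h, by omega, by omega⟩
  choose Y Kd J h1 h2 h3 using cov
  have uq : ∀ y k (j : ℕ), H y k → j < lenN p q k → Kd (y + j) = k ∧ J (y + j) = j := fun y k j h hj => by
    have a := h3 (y + j)
    have b := h2 (y + j)
    have c := hr.sp hp h (h1 (y + j))
    rw [← lenN_eq, ← lenN_eq] at c
    rcases c with ⟨c, d⟩ | c | c
    · exact ⟨d.symm, by omega⟩
    · omega
    · omega
  refine ⟨fun z => wt w (Kd z) (J z), fun z => ⟨tl_mem _, ?_, ?_, ?_⟩⟩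
  · have c := hc (Kd z)
    have a2 := h2 z
    by_cases e : J z < lenN p q (Kd z) - 1
    · have := uq (Y z) (Kd z) (J z + 1) (h1 z) (by omega)
      have hz : (Y z) + ((J z + 1 : ℕ) : ℤ) = z + 1 := by have := h3 z; push_cast; omega
      rw [hz] at this
      simp only [this]
      exact c.2.2 _ e
    · have e : J z = lenN p q (Kd z) - 1 := by omega
      obtain ⟨k', hk⟩ := hr.next _ _ (h1 z)
      rw [← lenN_eq] at hk
      have pos : 0 < lenN p q k' := by
        have := len_pos hp k'; have := hp.c; rw [← lenN_eq] at *; omega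
      have := uq _ k' 0 hk pos
      have hz : (Y z) + (lenN p q (Kd z) : ℤ) + ((0 : ℕ) : ℤ) = z + 1 := by have := h3 z; push_cast; omega
      rw [hz] at this
      simp only [this, e]
      rw [c.2.1, (hc k').1]
  · conv_rhs => rw [h3 z]
    exact (hb _ _ _ (h1 z) (h2 z)).symm
  · conv_rhs => rw [h3 z]
    exact (ht _ _ _ (h1 z) (h2 z)).symm

/-- A word that reads `F k` on each block of kind `k`. -/
theorem wordOf {p q : ℕ} (hp : Par p q) {H} (hr : Run p q H) (F : K → ℕ → Fin 2) :
    ∃ b : ℤ → Fin 2, ∀ y k (j : ℕ), H y k → j < lenN p q k → b (y + j) = F k j := by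
  have cov : ∀ z, ∃ y k, ∃ j : ℕ, H y k ∧ j < lenN p q k ∧ z = y + j := fun z => by
    obtain ⟨y, k, h, h1, h2⟩ := hr.cover hp z
    rw [← lenN_eq] at h2
    exact ⟨y, k, (z - y).toNat, h, by omega, by omega⟩
  choose Y Kd J h1 h2 h3 using cov
  refine ⟨fun z => F (Kd z) (J z), fun y k j h hj => ?_⟩
  have a := h3 (y + j)
  have b := h2 (y + j)
  have c := hr.sp hp h (h1 (y + j))
  rw [← lenN_eq, ← lenN_eq] at c
  rcases c with ⟨c, d⟩ | c | c
  · show F (Kd (y + j)) (J (y + j)) = F k j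
    rw [← d, show J (y + j) = j by omega]
  · omega
  · omega

def w00 : K → List ℕ
  | k1 => [21, 19, 25, 14, 16]
  | k2 => [21, 19, 24, 22, 26]
  | k3 => [21, 19, 25, 14, 17, 15, 23, 26]
  | k4 => [21, 19, 25, 20, 18, 27, 22, 26]
  | k5 => [21, 19, 25, 20, 18, 27, 17, 15, 23, 26]
def w10 : K → List ℕ
  | k1 => [3, 1, 5, 4, 10, 12, 4, 7]
  | k2 => [3, 1, 6, 2, 0, 5, 4, 7]
  | k3 => [3, 1, 5, 9, 8, 11, 0, 6, 2, 0, 5, 4, 7]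
  | k4 => [3, 1, 5, 4, 7, 3, 1, 6, 2, 0, 5, 4, 7]
  | k5 => [3, 1, 5, 4, 7, 3, 1, 5, 4, 10, 13, 2, 0, 5, 4, 7]
def w11 : K → List ℕ
  | k1 => [5, 4, 10, 12, 9, 8, 11, 0]
  | k2 => [6, 2, 0, 5, 9, 8, 11, 0]
  | k3 => [5, 4, 10, 12, 9, 8, 11, 0, 5, 9, 8, 11, 0]
  | k4 => [5, 4, 10, 12, 4, 7, 3, 1, 5, 9, 8, 11, 0]
  | k5 => [5, 4, 10, 13, 2, 0, 5, 9, 8, 11, 0, 5, 9, 8, 11, 0]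
def w20 : K → List ℕ
  | k1 => [21, 19, 25, 20, 18, 27, 22, 26, 21, 19, 25, 14, 16]
  | k2 => [21, 19, 25, 20, 18, 27, 22, 26, 21, 19, 24, 22, 26]
  | k3 => [21, 19, 25, 20, 18, 27, 22, 26, 21, 19, 25, 14, 17, 15, 23, 26, 21, 19, 24, 22, 26]
  | k4 => [21, 19, 25, 20, 18, 27, 22, 26, 21, 19, 25, 20, 18, 27, 22, 26, 21, 19, 24, 22, 26]
  | k5 => [21, 19, 25, 20, 18, 27, 22, 26, 21, 19, 25, 20, 18, 27, 22, 26, 21, 19, 25, 14, 16, 21, 19, 24, 22, 26]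
def w21 : K → List ℕ
  | k1 => [7, 3, 1, 5, 9, 8, 11, 0, 6, 2, 0, 5, 4]
  | k2 => [7, 3, 1, 5, 9, 8, 11, 0, 5, 4, 10, 12, 4]
  | k3 => [7, 3, 1, 5, 9, 8, 11, 0, 6, 2, 0, 5, 4, 7, 3, 1, 5, 4, 10, 12, 4]
  | k4 => [7, 3, 1, 5, 9, 8, 11, 0, 6, 2, 0, 5, 9, 8, 11, 0, 5, 4, 10, 12, 4]
  | k5 => [7, 3, 1, 5, 9, 8, 11, 0, 6, 2, 0, 5, 9, 8, 11, 0, 5, 4, 7, 3, 1, 5, 4, 10, 12, 4]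
def w22 : K → List ℕ
  | k1 => [14, 17, 15, 23, 26, 21, 19, 25, 14, 16, 21, 19, 25]
  | k2 => [14, 17, 15, 23, 26, 21, 19, 24, 22, 26, 21, 19, 25]
  | k3 => [14, 17, 15, 23, 26, 21, 19, 25, 14, 16, 21, 19, 25, 14, 17, 15, 23, 26, 21, 19, 25]
  | k4 => [14, 17, 15, 23, 26, 21, 19, 25, 14, 16, 21, 19, 25, 20, 18, 27, 22, 26, 21, 19, 25]
  | k5 => [14, 17, 15, 23, 26, 21, 19, 25, 14, 16, 21, 19, 24, 22, 26, 21, 19, 25, 14, 17, 15, 23, 26, 21, 19, 25]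

theorem c00 : chkW 5 8 .M w00 := by intro k; cases k <;> decide
theorem c10 : chkW 8 13 .e w10 := by intro k; cases k <;> decide
theorem c11 : chkW 8 13 .b w11 := by intro k; cases k <;> decide
theorem c20 : chkW 13 21 .M w20 := by intro k; cases k <;> decide
theorem c21 : chkW 13 21 .d w21 := by intro k; cases k <;> decide
theorem c22 : chkW 13 21 .P w22 := by intro k; cases k <;> decide

def ev : ℕ → Bool
  | 0 => true
  | n + 1 => not (ev n)

def Q (n : ℕ) : Prop := ∀ H, RunL n H → ∃ (D : ℤ) (m : ℕ), n < m ∧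
  St m (bits (ev n) (in2 (P n) (P (n + 1)) H) (in3 H))
    (fun z => bits (!ev n) (out2 (P n) (P (n + 1)) H) (out3 (P n) (P (n + 1)) H) (z + D))

theorem Q.mk (n : ℕ) (h : ∀ H, RunL n H → ∃ (s D : ℤ) (m : ℕ), n < m ∧
  St m (fun z => bits (ev n) (in2 (P n) (P (n + 1)) H) (in3 H) (z + s))
    (fun z => bits (!ev n) (out2 (P n) (P (n + 1)) H) (out3 (P n) (P (n + 1)) H) (z + D))) : Q n := by
  intro H hH
  obtain ⟨s, D, m, hm, h⟩ := h H hH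
  refine ⟨-s + D, m, hm, ?_⟩
  have := h.shift (-s)
  simp only [neg_add_cancel_right, add_assoc, neg_add_cancel, add_zero] at this
  exact this

theorem Run.mk2 {p q : ℤ} {H} (hr : Run p q H) (hp : Par p q) {y k} (h : H y k) {j : ℤ}
    (h0 : 0 ≤ j) (h1 : j < len p q k) (k' : K) (d : ℤ) (x : ℤ) (hx : x = y + j - d) (hd : 0 ≤ d) (hd' : d < len p q k') :
    H x k' ↔ k = k' ∧ j = d := by subst hx; exact hr.markAt hp h h0 h1 k' d hd hd'

theorem bits_true {m2 m3 : ℤ → Prop} {z : ℤ} {v : Fin 2}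
    (h : v = 1 ↔ m2 z ∨ m2 (z - 1) ∨ m3 z ∨ m3 (z - 1) ∨ m3 (z - 2)) : bits true m2 m3 z = v := by
  unfold bits
  rw [if_pos rfl]
  split_ifs with c
  · exact (h.2 c).symm
  · have : v ≠ 1 := fun e => c (h.1 e)
    revert this
    clear * -
    revert v; decide

theorem bits_false {m2 m3 : ℤ → Prop} {z : ℤ} {v : Fin 2}
    (h : v = 0 ↔ m2 (z + 1) ∨ m2 (z + 2) ∨ m3 (z + 1) ∨ m3 (z + 2) ∨ m3 (z + 3)) :
    bits false m2 m3 z = v := by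
  unfold bits
  rw [if_neg (by decide)]
  split_ifs with c
  · exact (h.2 c).symm
  · have : v ≠ 0 := fun e => c (h.1 e)
    revert this
    clear * -
    revert v; decide

theorem Q0 : Q 0 := by
  apply Q.mk
  intro H hH
  have hp : Par ((5 : ℕ) : ℤ) ((8 : ℕ) : ℤ) := P_par 0
  have hr : Run ((5 : ℕ) : ℤ) ((8 : ℕ) : ℤ) H := hH
  refine ⟨-3, -4, 1, by norm_num, _, rowOf hp hr c00 ?_ ?_, rfl⟩
  · intro y k j h hj
    have hj' : (j : ℤ) < len (5 : ℕ) (8 : ℕ) k := by rw [← lenN_eq]; omega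
    have m := hr.mk2 hp h (Int.natCast_nonneg j) hj'
    refine bits_true ?_
    simp only [in2, in3, P, zero_add]
    rw [m k1 3 _ (by ring) (by decide) (by decide),
      m k5 6 _ (by ring) (by decide) (by decide),
      m k1 4 _ (by ring) (by decide) (by decide),
      m k5 7 _ (by ring) (by decide) (by decide),
      m k3 3 _ (by ring) (by decide) (by decide),
      m k3 4 _ (by ring) (by decide) (by decide),
      m k3 5 _ (by ring) (by decide) (by decide)]
    clear m hj' h
    revert j
    cases k <;> decide +kernel
  · intro y k j h hj
    have hj' : (j : ℤ) < len (5 : ℕ) (8 : ℕ) k := by rw [← lenN_eq]; omega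
    have m := hr.mk2 hp h (Int.natCast_nonneg j) hj'
    refine bits_false ?_
    simp only [out2, out3, P, zero_add]
    rw [m k2 3 _ (by ring) (by decide) (by decide),
      m k5 5 _ (by ring) (by decide) (by decide),
      m k2 2 _ (by ring) (by decide) (by decide),
      m k5 4 _ (by ring) (by decide) (by decide),
      m k4 6 _ (by ring) (by decide) (by decide),
      m k4 5 _ (by ring) (by decide) (by decide),
      m k4 4 _ (by ring) (by decide) (by decide)]
    clear m hj' h
    revert j
    cases k <;> decide +kernel

theorem Q1 : Q 1 := by
  apply Q.mk
  intro H hH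
  have hp : Par ((8 : ℕ) : ℤ) ((13 : ℕ) : ℤ) := P_par 1
  have hr : Run ((8 : ℕ) : ℤ) ((13 : ℕ) : ℤ) H := hH
  obtain ⟨b, hb⟩ := wordOf hp hr (fun k j => (wt w10 k j).north)
  refine ⟨-6, 0, 2, by norm_num, _, rowOf hp hr c10 ?_ hb, _,
    rowOf hp hr c11 (fun y k j h hj => (hb y k j h hj).trans ?_) ?_, rfl⟩
  · intro y k j h hj
    have hj' : (j : ℤ) < len (8 : ℕ) (13 : ℕ) k := by rw [← lenN_eq]; omega
    have m := hr.mk2 hp h (Int.natCast_nonneg j) hj'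
    refine bits_false ?_
    simp only [in2, in3, P, zero_add]
    rw [m k1 5 _ (by ring) (by decide) (by decide),
      m k5 10 _ (by ring) (by decide) (by decide),
      m k1 4 _ (by ring) (by decide) (by decide),
      m k5 9 _ (by ring) (by decide) (by decide),
      m k3 5 _ (by ring) (by decide) (by decide),
      m k3 4 _ (by ring) (by decide) (by decide),
      m k3 3 _ (by ring) (by decide) (by decide)]
    clear m hj' h
    revert j
    cases k <;> decide +kernel
  · clear h
    revert j
    cases k <;> decide +kernel
  · intro y k j h hj
    have hj' : (j : ℤ) < len (8 : ℕ) (13 : ℕ) k := by rw [← lenN_eq]; omega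
    have m := hr.mk2 hp h (Int.natCast_nonneg j) hj'
    refine bits_true ?_
    simp only [out2, out3, P, zero_add]
    rw [m k2 0 _ (by ring) (by decide) (by decide),
      m k5 3 _ (by ring) (by decide) (by decide),
      m k2 1 _ (by ring) (by decide) (by decide),
      m k5 4 _ (by ring) (by decide) (by decide),
      m k4 5 _ (by ring) (by decide) (by decide),
      m k4 6 _ (by ring) (by decide) (by decide),
      m k4 7 _ (by ring) (by decide) (by decide)]
    clear m hj' h
    revert j
    cases k <;> decide +kernel

theorem Q2 : Q 2 := by
  apply Q.mk
  intro H hH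
  have hp : Par ((13 : ℕ) : ℤ) ((21 : ℕ) : ℤ) := P_par 2
  have hr : Run ((13 : ℕ) : ℤ) ((21 : ℕ) : ℤ) H := hH
  obtain ⟨b, hb⟩ := wordOf hp hr (fun k j => (wt w20 k j).north)
  obtain ⟨c, hc⟩ := wordOf hp hr (fun k j => (wt w21 k j).north)
  refine ⟨-11, -9, 3, by norm_num, _, rowOf hp hr c20 ?_ hb, _,
    rowOf hp hr c21 (fun y k j h hj => (hb y k j h hj).trans ?_) hc, _,
    rowOf hp hr c22 (fun y k j h hj => (hc y k j h hj).trans ?_) ?_, rfl⟩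
  · intro y k j h hj
    have hj' : (j : ℤ) < len (13 : ℕ) (21 : ℕ) k := by rw [← lenN_eq]; omega
    have m := hr.mk2 hp h (Int.natCast_nonneg j) hj'
    refine bits_true ?_
    simp only [in2, in3, P, zero_add]
    rw [m k1 11 _ (by ring) (by decide) (by decide),
      m k5 19 _ (by ring) (by decide) (by decide),
      m k1 12 _ (by ring) (by decide) (by decide),
      m k5 20 _ (by ring) (by decide) (by decide),
      m k3 11 _ (by ring) (by decide) (by decide),
      m k3 12 _ (by ring) (by decide) (by decide),
      m k3 13 _ (by ring) (by decide) (by decide)]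
    clear m hj' h
    revert j
    cases k <;> decide +kernel
  · clear h
    revert j
    cases k <;> decide +kernel
  · clear h
    revert j
    cases k <;> decide +kernel
  · intro y k j h hj
    have hj' : (j : ℤ) < len (13 : ℕ) (21 : ℕ) k := by rw [← lenN_eq]; omega
    have m := hr.mk2 hp h (Int.natCast_nonneg j) hj'
    refine bits_false ?_
    simp only [out2, out3, P, zero_add]
    rw [m k2 8 _ (by ring) (by decide) (by decide),
      m k5 13 _ (by ring) (by decide) (by decide),
      m k2 7 _ (by ring) (by decide) (by decide),
      m k5 12 _ (by ring) (by decide) (by decide),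
      m k4 16 _ (by ring) (by decide) (by decide),
      m k4 15 _ (by ring) (by decide) (by decide),
      m k4 14 _ (by ring) (by decide) (by decide)]
    clear m hj' h
    revert j
    cases k <;> decide +kernel

end
end TDProof

namespace TDProof
open K
set_option linter.all false
noncomputable section

theorem Q.step {n : ℕ} (h0 : Q n) (h1 : Q (n + 1)) : Q (n + 3) := by
  intro G hG
  have e3 : P (n + 3) = P n + 2 * P (n + 1) := by simp only [P]; ring
  have e4 : P (n + 3 + 1) = 2 * P n + 3 * P (n + 1) := by simp only [P]; ring
  have e2 : P (n + 1 + 1) = P n + P (n + 1) := rfl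
  have hp := P_par n
  unfold RunL at hG
  rw [e3, e4] at hG
  obtain ⟨B, dB⟩ : ∃ B, Dec (P (n + 1)) (P n + P (n + 1)) B G bB := ⟨_, fun x k => Iff.rfl⟩
  obtain ⟨M, dM⟩ : ∃ M, Dec (P n) (P (n + 1)) M G bM := ⟨_, fun x k => Iff.rfl⟩
  obtain ⟨A, dA⟩ : ∃ A, Dec (P (n + 1)) (P n + P (n + 1)) A G bA := ⟨_, fun x k => Iff.rfl⟩
  have rB := dB.run hp.step hp.step3 hG totB
  have rM := dM.run hp hp.step3 hG totM
  have rA := dA.run hp.step hp.step3 hG totA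
  obtain ⟨d1, m1, l1, s1⟩ := h1 B rB
  obtain ⟨d2, m2, l2, s2⟩ := h0 M rM
  obtain ⟨d3, m3, l3, s3⟩ := h1 A rA
  rw [e2] at s1 s3
  have x1 : in2 (P (n + 1)) (P n + P (n + 1)) B = in2 (P n + 2 * P (n + 1)) (2 * P n + 3 * P (n + 1)) G :=
    funext fun x => propext (dB.in2B x)
  have x2 : in3 B = in3 G := funext fun x => propext (dB.in3B x)
  have x3 : out2 (P (n + 1)) (P n + P (n + 1)) B = in2 (P n) (P (n + 1)) M :=
    funext fun x => propext ((dB.matchBM dM).m2 x)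
  have x4 : out3 (P (n + 1)) (P n + P (n + 1)) B = in3 M := funext fun x => propext ((dB.matchBM dM).m3 x)
  have x5 : out2 (P n) (P (n + 1)) M = in2 (P (n + 1)) (P n + P (n + 1)) A :=
    funext fun x => propext ((dM.matchMA dA).m2 x)
  have x6 : out3 (P n) (P (n + 1)) M = in3 A := funext fun x => propext ((dM.matchMA dA).m3 x)
  have x7 : out2 (P (n + 1)) (P n + P (n + 1)) A = out2 (P n + 2 * P (n + 1)) (2 * P n + 3 * P (n + 1)) G :=
    funext fun x => propext (dA.out2A x)
  have x8 : out3 (P (n + 1)) (P n + P (n + 1)) A = out3 (P n + 2 * P (n + 1)) (2 * P n + 3 * P (n + 1)) G :=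
    funext fun x => propext (dA.out3A x)
  rw [x1, x2, x3, x4] at s1
  rw [x5, x6] at s2
  rw [x7, x8] at s3
  simp only [ev, Bool.not_not] at s1 s3
  refine ⟨d3 + (d2 + d1), m1 + (m2 + m3), by omega, ?_⟩
  rw [e3, e4]
  simp only [ev, Bool.not_not]
  refine s1.append ((s2.shift d1).append ?_)
  have := s3.shift (d2 + d1)
  convert this using 3 <;> ring

theorem Q.all : ∀ n, Q n
  | 0 => Q0
  | 1 => Q1
  | 2 => Q2
  | n + 3 => (Q.all n).step (Q.all (n + 1))

theorem exRun (n : ℕ) : ∃ H, RunL n H := by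
  have hp := P_par n
  have p0 : 0 < P n := by have := hp.a; have := hp.b; have := hp.c; omega
  refine ⟨fun x k => k = k1 ∧ P n ∣ x, Run.mk' hp ?_ ?_ ?_⟩
  · intro z
    refine ⟨z - z % P n, k1, by have := Int.emod_nonneg z p0.ne'; omega, rfl, Int.dvd_self_sub_emod⟩
  · rintro x k ⟨rfl, h⟩
    exact ⟨k1, rfl, dvd_add h (by simp)⟩
  · rintro x k x' k' ⟨rfl, h⟩ ⟨rfl, h'⟩ h1 h2
    simp only [len_k1] at h2
    have := Int.le_of_dvd (a := P n) (b := x' - x)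
    refine ⟨?_, rfl⟩
    by_contra hne
    have := this (by omega) (dvd_sub h' h)
    omega

theorem St.ex {m b t} (h : St m b t) : ∃ g : ℕ → ℤ → WT, (∀ y x, g y x ∈ TD) ∧
    (∀ y x, y < m → (g y x).east = (g y (x + 1)).west) ∧
    (∀ y x, y + 1 < m → (g y x).north = (g (y + 1) x).south) ∧ (0 < m → ∀ x, (g 0 x).south = b x) := by
  induction m generalizing b with
  | zero => exact ⟨fun _ _ => tl 0, fun _ _ => tl_mem _, by omega, by omega, by omega⟩
  | succ m ih =>
    obtain ⟨c, ⟨r, hr⟩, h2⟩ := h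
    obtain ⟨g, g1, g2, g3, g4⟩ := ih h2
    refine ⟨fun y => match y with | 0 => r | y + 1 => g y, ?_, ?_, ?_, ?_⟩
    · rintro (_ | y) x
      · exact (hr x).1
      · exact g1 y x
    · rintro (_ | y) x hy
      · exact (hr x).2.1
      · exact g2 y x (by omega)
    · rintro (_ | y) x hy
      · exact (hr x).2.2.2.trans (g4 (by omega) x).symm
      · exact g3 y x (by omega)
    · intro _ x
      exact (hr x).2.2.1

def Cn (n : ℕ) : Set (ℤ × ℤ → TD) := {f | ∀ x y : ℤ, -n ≤ y → y < n →
  (f (x, y)).1.east = (f (x + 1, y)).1.west ∧ (f (x, y)).1.north = (f (x, y + 1)).1.south}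

theorem Cn_ne (n : ℕ) : (Cn n).Nonempty := by
  obtain ⟨H, hH⟩ := exRun (2 * n + 1)
  obtain ⟨D, m, hm, h⟩ := Q.all _ H hH
  obtain ⟨g, g1, g2, g3, -⟩ := h.ex
  refine ⟨fun p => ⟨g (p.2 + n).toNat p.1, g1 _ _⟩, fun x y h1 h2 => ⟨?_, ?_⟩⟩
  · exact g2 _ _ (by omega)
  · have := g3 (y + n).toNat x (by omega)
    have e : (y + 1 + n).toNat = (y + n).toNat + 1 := by omega
    simp only [e]
    exact this

theorem tiles : TilesPlane TD := by
  haveI : Finite TD := TD_fin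
  letI : TopologicalSpace TD := ⊥
  haveI : DiscreteTopology TD := ⟨rfl⟩
  have cl : ∀ (R : TD → TD → Prop) (p q : ℤ × ℤ), IsClosed {f : ℤ × ℤ → TD | R (f p) (f q)} := by
    intro R p q
    have : IsClosed {z : TD × TD | R z.1 z.2} := isClosed_discrete _
    have hc : Continuous (fun f : ℤ × ℤ → TD => (f p, f q)) := by fun_prop
    exact this.preimage hc
  have hcl : ∀ n, IsClosed (Cn n) := fun n => by
    unfold Cn
    simp only [Set.setOf_forall, Set.setOf_and]
    refine isClosed_iInter fun x => isClosed_iInter fun y => isClosed_iInter fun _ => isClosed_iInter fun _ => ?_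
    exact (cl (fun s t => s.1.east = t.1.west) _ _).inter (cl (fun s t => s.1.north = t.1.south) _ _)
  obtain ⟨f, hf⟩ := IsCompact.nonempty_iInter_of_sequence_nonempty_isCompact_isClosed Cn
    (fun n f hf x y h1 h2 => hf x y (by push_cast; omega) (by push_cast; omega)) Cn_ne (hcl 0).isCompact hcl
  rw [Set.mem_iInter] at hf
  refine ⟨fun p => (f p).1, fun p _ => (f p).2, fun x y _ _ => ?_, fun x y _ _ => ?_⟩
  · exact (hf (y.natAbs + 1) x y (by omega) (by omega)).1
  · exact (hf (y.natAbs + 1) x y (by omega) (by omega)).2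
end
end TDProof

/-- the Wang set `𝒯_D = 𝒯_a ∪ 𝒯_b` is aperiodic: it tiles the plane and
no tiling of the plane by it is periodic. -/
theorem TD_aperiodic : Aperiodic TD := by
  exact ⟨TDProof.tiles, TDProof.no_period⟩
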